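/- arXiv:2207.14523 — 2 statements merged into one kernel-verified Lean document; each statement's English description precedes it below -/
import Mathlib

section
/- Every convenient power series f ∈ K[[x,y]] (K algebraically closed) is a product f = g₁⋯g_s of elementary power series with I(g₁) < I(g₂) < ⋯ < I(g_s), where I(g) = m/n for an elementary g of bidegree (m,n). -/
/-!
Common definitions for formalizing "A note on the plane curve singularities in
positive characteristic" by E. García Barroso and A. Płoski.

We work with the ring `K[[x,y]] := MvPowerSeries (Fin 2) K`, where `x` is the
variable of index `0` and `y` the variable of index `1`.
-/

open scoped Classical

noncomputable section

universe u

namespace PlaneCurveNote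

/-- The formal power series ring `K[[x,y]]`. -/
abbrev PS (K : Type u) [Field K] := MvPowerSeries (Fin 2) K

variable (K : Type u) [Field K]

/-- The variable `x`. -/
def Xv : PS K := MvPowerSeries.X 0

/-- The variable `y`. -/
def Yv : PS K := MvPowerSeries.X 1

/-- The coefficient `c_{αβ}` of `x^α y^β` in `f`. -/
def coef (f : PS K) (p : ℕ × ℕ) : K :=
  MvPowerSeries.coeff (R := K) (Finsupp.single 0 p.1 + Finsupp.single 1 p.2) f

/-- The support of a power series, as a subset of `ℕ²`. -/
def supp (f : PS K) : Set (ℕ × ℕ) := {p | coef K f p ≠ 0}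

/-- Build a power series from a coefficient function on `ℕ²`. -/
def ofCoef (c : ℕ × ℕ → K) : PS K := fun d => c (d 0, d 1)

/-- A reduced power series: nonzero, without constant term and without multiple factors. -/
def IsReducedSeries (f : PS K) : Prop :=
  f ≠ 0 ∧ MvPowerSeries.constantCoeff (σ := Fin 2) (R := K) f = 0 ∧ Squarefree f

/-- `r(f)`: the number of irreducible factors of `f` (counted up to associates,
i.e. the number of distinct irreducible components of the curve `f = 0` when `f` is reduced). -/
def numFactors (f : PS K) : ℕ :=
  Set.ncard {P : Associates (PS K) | Irreducible P ∧ P ∣ Associates.mk f}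

/-- The local ring `O_f = K[[x,y]]/(f)` of the curve `f = 0`. -/
abbrev CurveRing (f : PS K) := PS K ⧸ Ideal.span ({f} : Set (PS K))

/-- `deltaSpec K f d` expresses that `d = δ(f) = dim_K Ō_f/O_f`, where `Ō_f` is the integral
closure of `O_f = K[[x,y]]/(f)` in (any model `L` of) its total ring of fractions. -/
def deltaSpec (f : PS K) (d : ℕ) : Prop :=
  ∀ (L : Type u) [CommRing L] [Algebra K L] [Algebra (CurveRing K f) L]
    [IsScalarTower K (CurveRing K f) L] [IsFractionRing (CurveRing K f) L],
    letI N : Submodule K L := Submodule.span K ((integralClosure (CurveRing K f) L : Set L))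
    letI P : Submodule K L := Submodule.span K (Set.range (algebraMap (CurveRing K f) L))
    d = Module.finrank K (↥N ⧸ (P.comap N.subtype))

/-- `δ(f)`, the delta invariant of `f`. -/
def delta (f : PS K) : ℕ := sInf {d | deltaSpec K f d}

/-- `μ̄(f) = 2δ(f) - r(f) + 1`, the invariant Milnor number of `f`. -/
def muBar (f : PS K) : ℤ := 2 * (delta K f : ℤ) - (numFactors K f : ℤ) + 1

/-- `i₀(f,g) = dim_K K[[x,y]]/(f,g)`, the intersection multiplicity of `f` and `g`
(as a natural number; meaningful when it is finite). -/
def iMult (f g : PS K) : ℕ :=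
  Module.finrank K (PS K ⧸ Ideal.span ({f, g} : Set (PS K)))

/-- `i₀(f,g)` as a cardinal (`dim_K K[[x,y]]/(f,g)`), allowing the infinite case. -/
def iMultC (f g : PS K) : Cardinal :=
  Module.rank K (PS K ⧸ Ideal.span ({f, g} : Set (PS K)))

/-- `Γ(f)`: the semigroup of values of an irreducible `f`, i.e. the set of intersection
multiplicities `i₀(f,g)` where `g` runs over power series with `g ≢ 0 (mod f)`. -/
def valueSemigroup (f : PS K) : Set ℕ :=
  {n | ∃ g : PS K, ¬ f ∣ g ∧ n = iMult K f g}

/-- `ord f`, the order of a power series. -/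
def ordSeries (f : PS K) : ℕ := sInf ((fun p => p.1 + p.2) '' supp K f)

/-- `m = ord f(x,0)`. -/
def ordX (f : PS K) : ℕ := sInf {a : ℕ | (a, 0) ∈ supp K f}

/-- `n = ord f(0,y)`. -/
def ordY (f : PS K) : ℕ := sInf {b : ℕ | (0, b) ∈ supp K f}

/-- `f` is convenient if `f(x,0) f(0,y) ≠ 0`. -/
def Convenient (f : PS K) : Prop :=
  (∃ a : ℕ, (a, 0) ∈ supp K f) ∧ (∃ b : ℕ, (0, b) ∈ supp K f)

/-- A Newton edge: a segment with vertices `(α,β)`, `(α',β') ∈ ℕ²`, `α < α'`, `β' < β`. -/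
structure NEdge : Type where
  A : ℕ × ℕ
  B : ℕ × ℕ
  hx : A.1 < B.1
  hy : B.2 < A.2

/-- `|S|₁ = α' - α`. -/
def NEdge.len1 (S : NEdge) : ℕ := S.B.1 - S.A.1

/-- `|S|₂ = β - β'`. -/
def NEdge.len2 (S : NEdge) : ℕ := S.A.2 - S.B.2

/-- `r(S) = gcd(|S|₁, |S|₂)`. -/
def NEdge.rE (S : NEdge) : ℕ := Nat.gcd S.len1 S.len2

/-- The lattice points lying on the segment `S`. -/
def NEdge.mem (S : NEdge) (p : ℕ × ℕ) : Prop :=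
  S.A.1 ≤ p.1 ∧ p.1 ≤ S.B.1 ∧ S.B.2 ≤ p.2 ∧ p.2 ≤ S.A.2 ∧
    (p.1 - S.A.1) * S.len2 = (S.A.2 - p.2) * S.len1

/-- `[S,T] = min{|S|₁|T|₂, |S|₂|T|₁}`. -/
def bracket (S T : NEdge) : ℕ := min (S.len1 * T.len2) (S.len2 * T.len1)

/-- The Newton polygon `N_f` of `f`, described as the set of compact edges of the boundary of
the Newton diagram of `f`: an edge belongs to `N_f` iff its endpoints lie in the support of `f`
and some weight vector `w` with positive entries attains its minimum on the support of `f`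
exactly on this segment. -/
def newtonPolygon (f : PS K) : Set NEdge :=
  {S | S.A ∈ supp K f ∧ S.B ∈ supp K f ∧
    ∃ w : ℕ × ℕ, 0 < w.1 ∧ 0 < w.2 ∧
      w.1 * S.B.1 + w.2 * S.B.2 = w.1 * S.A.1 + w.2 * S.A.2 ∧
      (∀ p ∈ supp K f, w.1 * S.A.1 + w.2 * S.A.2 ≤ w.1 * p.1 + w.2 * p.2) ∧
      (∀ p ∈ supp K f, w.1 * p.1 + w.2 * p.2 = w.1 * S.A.1 + w.2 * S.A.2 →
        S.A.1 ≤ p.1 ∧ p.1 ≤ S.B.1)}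

/-- `|N_f|₁ = Σ_{S ∈ N_f} |S|₁`. -/
def len1N (f : PS K) : ℕ := ∑ᶠ S ∈ newtonPolygon K f, S.len1

/-- `|N_f|₂ = Σ_{S ∈ N_f} |S|₂`. -/
def len2N (f : PS K) : ℕ := ∑ᶠ S ∈ newtonPolygon K f, S.len2

/-- `[N_f, N_f] = Σ_{S,T ∈ N_f} [S,T]`. -/
def bracketN (f : PS K) : ℕ := ∑ᶠ S ∈ newtonPolygon K f, ∑ᶠ T ∈ newtonPolygon K f, bracket S T

/-- `k`: the exponent of the highest power of `x` dividing `f`. -/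
def kdiv (f : PS K) : ℕ := sInf {a : ℕ | ∃ b : ℕ, (a, b) ∈ supp K f}

/-- `l`: the exponent of the highest power of `y` dividing `f`. -/
def ldiv (f : PS K) : ℕ := sInf {b : ℕ | ∃ a : ℕ, (a, b) ∈ supp K f}

/-- `r(N_f) = Σ_{S ∈ N_f} r(S) + k + l`, where `x^k y^l` is the monomial of highest degree
dividing `f`. -/
def rNewton (f : PS K) : ℕ := (∑ᶠ S ∈ newtonPolygon K f, S.rE) + kdiv K f + ldiv K f

/-- `μ(N_f) = [N_f,N_f] - |N_f|₁ - |N_f|₂ + 1` (the Newton number of a convenient series). -/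
def muNewtonConv (f : PS K) : ℤ :=
  (bracketN K f : ℤ) - (len1N K f : ℤ) - (len2N K f : ℤ) + 1

/-- `μ(N_f) = sup_{m ∈ ℕ} μ(N_{f + x^m + y^m})`: the Newton number of an arbitrary
(reduced) power series. -/
def muNewton (f : PS K) : ℤ :=
  sSup {z : ℤ | ∃ m : ℕ, z = muNewtonConv K (f + Xv K ^ m + Yv K ^ m)}

/-- `δ(N_f) = (μ(N_f) + r(N_f) - 1)/2`. -/
def deltaNewton (f : PS K) : ℤ := (muNewton K f + (rNewton K f : ℤ) - 1) / 2

/-- `in(f,S) = Σ_{(α,β) ∈ S} c_{αβ} x^α y^β`, the initial part of `f` along the edge `S`. -/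
def initialForm (f : PS K) (S : NEdge) : PS K :=
  ofCoef K fun p => if S.mem p then coef K f p else 0

/-- `ī(f,S)`: the convenient power series with `in(f,S) = x^{α(S)} y^{β(S)} ī(f,S)`,
where `x^{α(S)} y^{β(S)}` is the monomial of highest degree dividing `in(f,S)`. -/
def inBar (f : PS K) (S : NEdge) : PS K :=
  ofCoef K fun p =>
    if S.mem (p.1 + S.A.1, p.2 + S.B.2) then coef K f (p.1 + S.A.1, p.2 + S.B.2) else 0

/-- `f` is non-degenerate (in the sense of Beelen–Pellikaan) if `ī(f,S)` is reduced
(i.e. squarefree) for every edge `S ∈ N_f`. -/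
def NonDegenerate (f : PS K) : Prop :=
  ∀ S ∈ newtonPolygon K f, Squarefree (inBar K f S)

/-- `f` is elementary if it is convenient and `N_f` consists of a single edge. -/
def Elementary (f : PS K) : Prop :=
  Convenient K f ∧ ∃ S : NEdge, newtonPolygon K f = {S}

/-- Evaluation of a power series with finite support (e.g. an initial form) at a point of `K²`. -/
def psEval (f : PS K) (v : K × K) : K :=
  ∑ᶠ p : ℕ × ℕ, coef K f p * v.1 ^ p.1 * v.2 ^ p.2

/-- The partial derivative `∂f/∂x` (for `i = 0`) resp. `∂f/∂y` (for `i = 1`). -/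
def pderivSeries (i : Fin 2) (f : PS K) : PS K :=
  ofCoef K fun p =>
    if i = 0 then ((p.1 + 1 : ℕ) : K) * coef K f (p.1 + 1, p.2)
    else ((p.2 + 1 : ℕ) : K) * coef K f (p.1, p.2 + 1)

/-- `μ(f) = i₀(∂f/∂x, ∂f/∂y)`, the Milnor number of `f`. -/
def milnor (f : PS K) : ℕ := iMult K (pderivSeries K 0 f) (pderivSeries K 1 f)

/-- `f` is strongly non-degenerate (Kouchnirenko) if for every `S ∈ N_f` the solutions of
`∂in(f,S)/∂x = ∂in(f,S)/∂y = 0` are contained in `{xy = 0}`. -/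
def StronglyNonDegenerate (f : PS K) : Prop :=
  ∀ S ∈ newtonPolygon K f, ∀ v : K × K,
    psEval K (pderivSeries K 0 (initialForm K f S)) v = 0 →
    psEval K (pderivSeries K 1 (initialForm K f S)) v = 0 → v.1 * v.2 = 0

/-- The Newton diagram `Δ(f) ⊆ ℝ²`: the convex hull of `supp f + (ℝ_{≥0})²`. -/
def diagram (f : PS K) : Set (ℝ × ℝ) :=
  convexHull ℝ {q : ℝ × ℝ | ∃ p ∈ supp K f, (p.1 : ℝ) ≤ q.1 ∧ (p.2 : ℝ) ≤ q.2}

/-- A real point lies on the Newton polygon `N_f` (i.e. on a compact face of the boundary of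
the Newton diagram) iff it belongs to the diagram and some linear form with positive
coefficients attains its minimum over the diagram at this point. -/
def OnNewtonPolygon (f : PS K) (q : ℝ × ℝ) : Prop :=
  q ∈ diagram K f ∧ ∃ w : ℝ × ℝ, 0 < w.1 ∧ 0 < w.2 ∧
    ∀ p ∈ diagram K f, w.1 * q.1 + w.2 * q.2 ≤ w.1 * p.1 + w.2 * p.2

end PlaneCurveNote

namespace MvPowerSeries

open Finsupp

section Contraction

variable {σ R : Type*} [CommRing R] {w : σ → ℕ}

theorem le_weightedOrder_sub {f g : MvPowerSeries σ R} {n : ℕ∞}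
    (hf : n ≤ f.weightedOrder w) (hg : n ≤ g.weightedOrder w) :
    n ≤ (f - g).weightedOrder w := by
  rw [sub_eq_add_neg]
  refine le_trans (le_min hf ?_) (min_weightedOrder_le_add w)
  rwa [weightedOrder_neg]

theorem coeff_eq_of_lt_weightedOrder_sub {f g : MvPowerSeries σ R} {n : ℕ}
    (h : n ≤ (f - g).weightedOrder w) {d : σ →₀ ℕ} (hd : weight w d < n) :
    coeff d f = coeff d g := by
  rw [← sub_eq_zero, ← map_sub]
  exact coeff_eq_zero_of_lt_weightedOrder w (lt_of_lt_of_le (by exact_mod_cast hd) h)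

/-- A self-map of the series of weighted order at least `N` which strictly increases the weighted
order of differences has a fixed point. -/
theorem exists_fixedPoint_of_weightedOrder {N : ℕ} (T : MvPowerSeries σ R → MvPowerSeries σ R)
    (hT : ∀ z, (N : ℕ∞) ≤ z.weightedOrder w → (N : ℕ∞) ≤ (T z).weightedOrder w)
    (hc : ∀ z z' (j : ℕ), (N : ℕ∞) ≤ z.weightedOrder w → (N : ℕ∞) ≤ z'.weightedOrder w →
      ((N + j : ℕ) : ℕ∞) ≤ (z - z').weightedOrder w →
      ((N + (j + 1) : ℕ) : ℕ∞) ≤ (T z - T z').weightedOrder w) :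
    ∃ z, (N : ℕ∞) ≤ z.weightedOrder w ∧ T z = z := by
  set s : ℕ → MvPowerSeries σ R := fun k => T^[k] 0 with hs
  have hsucc : ∀ k, s (k + 1) = T (s k) := fun k => Function.iterate_succ_apply' T k 0
  have hN : ∀ k, (N : ℕ∞) ≤ (s k).weightedOrder w := by
    intro k
    induction k with
    | zero => simp [hs]
    | succ k ih => rw [hsucc]; exact hT _ ih
  have hcauchy : ∀ k j, ((N + k : ℕ) : ℕ∞) ≤ (s (k + j) - s k).weightedOrder w := by
    intro k
    induction k with
    | zero => intro j; exact le_weightedOrder_sub (by simpa using hN _) (by simpa using hN _)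
    | succ k ih =>
      intro j
      rw [show k + 1 + j = (k + j) + 1 by ring, hsucc, hsucc]
      exact hc _ _ _ (hN _) (hN _) (ih j)
  let z : MvPowerSeries σ R := fun d => coeff d (s (weight w d + 1))
  have hzc : ∀ d, coeff d z = coeff d (s (weight w d + 1)) := fun d => rfl
  have hz : ∀ k, ((N + k : ℕ) : ℕ∞) ≤ (z - s k).weightedOrder w := by
    intro k
    refine nat_le_weightedOrder w fun d hd => ?_
    rw [map_sub, hzc, sub_eq_zero]
    rcases le_total (weight w d + 1) k with h | h
    · obtain ⟨j, rfl⟩ := Nat.exists_eq_add_of_le h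
      exact (coeff_eq_of_lt_weightedOrder_sub (hcauchy _ j) (by omega)).symm
    · obtain ⟨j, hj⟩ := Nat.exists_eq_add_of_le h
      rw [hj]
      exact coeff_eq_of_lt_weightedOrder_sub (hcauchy _ j) hd
  have hzN : (N : ℕ∞) ≤ z.weightedOrder w := by simpa [hs] using hz 0
  refine ⟨z, hzN, ext fun d => ?_⟩
  have h₁ := hc z _ (weight w d) hzN (hN _) (hz (weight w d))
  rw [← hsucc] at h₁
  rw [hzc]
  exact coeff_eq_of_lt_weightedOrder_sub h₁ (by omega)

end Contraction

section Splitting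

variable {R : Type*} [CommRing R]

theorem weight_fin_two (w : Fin 2 → ℕ) (d : Fin 2 →₀ ℕ) :
    weight w d = d 0 * w 0 + d 1 * w 1 := by
  rw [weight_apply, Finsupp.sum_fintype _ _ (by simp)]
  simp

/-- The quotient of the part of `f` divisible by `x ^ a` by `x ^ a`. -/
def divX (a : ℕ) (f : MvPowerSeries (Fin 2) R) : MvPowerSeries (Fin 2) R :=
  fun d => coeff (d + single 0 a) f

/-- The quotient by `y ^ b` of the part of `f` made of the monomials divisible by `y ^ b` but
not by `x ^ a`. -/
def divY (a b : ℕ) (f : MvPowerSeries (Fin 2) R) : MvPowerSeries (Fin 2) R :=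
  fun d => if d 0 < a then coeff (d + single 1 b) f else 0

theorem coeff_divX (a : ℕ) (f : MvPowerSeries (Fin 2) R) (d : Fin 2 →₀ ℕ) :
    coeff d (divX a f) = coeff (d + single 0 a) f := rfl

theorem coeff_divY (a b : ℕ) (f : MvPowerSeries (Fin 2) R) (d : Fin 2 →₀ ℕ) :
    coeff d (divY a b f) = if d 0 < a then coeff (d + single 1 b) f else 0 := rfl

theorem divX_sub (a : ℕ) (f g : MvPowerSeries (Fin 2) R) :
    divX a (f - g) = divX a f - divX a g := by
  ext d
  simp [coeff_divX]

theorem divY_sub (a b : ℕ) (f g : MvPowerSeries (Fin 2) R) :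
    divY a b (f - g) = divY a b f - divY a b g := by
  ext d
  simp only [coeff_divY, map_sub]
  split_ifs <;> simp

theorem le_weightedOrder_divX {w : Fin 2 → ℕ} {a n : ℕ} {f : MvPowerSeries (Fin 2) R}
    (h : ((a * w 0 + n : ℕ) : ℕ∞) ≤ f.weightedOrder w) :
    (n : ℕ∞) ≤ (divX a f).weightedOrder w := by
  refine nat_le_weightedOrder w fun d hd => ?_
  rw [coeff_divX]
  refine coeff_eq_zero_of_lt_weightedOrder w (lt_of_lt_of_le ?_ h)
  simp only [weight_fin_two] at hd ⊢
  norm_cast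
  simp [add_mul]
  omega

theorem le_weightedOrder_divY {w : Fin 2 → ℕ} {a b n : ℕ} {f : MvPowerSeries (Fin 2) R}
    (h : ((b * w 1 + n : ℕ) : ℕ∞) ≤ f.weightedOrder w) :
    (n : ℕ∞) ≤ (divY a b f).weightedOrder w := by
  refine nat_le_weightedOrder w fun d hd => ?_
  rw [coeff_divY]
  split_ifs with ha
  swap
  · rfl
  refine coeff_eq_zero_of_lt_weightedOrder w (lt_of_lt_of_le ?_ h)
  simp only [weight_fin_two] at hd ⊢
  norm_cast
  simp [add_mul]
  omega

theorem X_pow_mul_divX_add_X_pow_mul_divY {w : Fin 2 → ℕ} {a b : ℕ}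
    {f : MvPowerSeries (Fin 2) R}
    (h : ((a * w 0 + b * w 1 + 1 : ℕ) : ℕ∞) ≤ f.weightedOrder w) :
    X 0 ^ a * divX a f + X 1 ^ b * divY a b f = f := by
  have hsub : ∀ (i : Fin 2) (n : ℕ) (d : Fin 2 →₀ ℕ), n ≤ d i → d - single i n + single i n = d :=
    fun i n d hn => tsub_add_cancel_of_le (by simpa using hn)
  ext d
  rw [map_add, X_pow_eq, X_pow_eq, coeff_monomial_mul, coeff_monomial_mul, one_mul, one_mul,
    coeff_divX, coeff_divY]
  simp only [single_le_iff]
  have h0 : (d - single 1 b : Fin 2 →₀ ℕ) 0 = d 0 := by simp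
  rw [h0]
  by_cases ha : a ≤ d 0
  · rw [if_pos ha, hsub 0 a d ha, if_neg (not_lt.2 ha)]
    simp
  · rw [if_neg ha, if_pos (not_le.1 ha), zero_add]
    split_ifs with hb
    · rw [hsub 1 b d hb]
    · refine (coeff_eq_zero_of_lt_weightedOrder w (lt_of_lt_of_le ?_ h)).symm
      rw [weight_fin_two]
      norm_cast
      push Not at ha hb
      have h₁ := Nat.mul_le_mul_right (w 0) ha.le
      have h₂ := Nat.mul_le_mul_right (w 1) hb.le
      omega

/-- A series whose initial form for some weight is the monomial `x ^ a * y ^ b` is the product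
of a series with initial form `x ^ a` and of a series with initial form `y ^ b`. -/
theorem exists_mul_eq_of_weightedOrder {w : Fin 2 → ℕ} {a b : ℕ} {f : MvPowerSeries (Fin 2) R}
    (h : ((a * w 0 + b * w 1 + 1 : ℕ) : ℕ∞) ≤ (f - X 0 ^ a * X 1 ^ b).weightedOrder w) :
    ∃ u v : MvPowerSeries (Fin 2) R, f = (X 0 ^ a + u) * (X 1 ^ b + v) ∧
      ((a * w 0 + 1 : ℕ) : ℕ∞) ≤ u.weightedOrder w ∧
      ((b * w 1 + 1 : ℕ) : ℕ∞) ≤ v.weightedOrder w := by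
  have hX : ∀ {z : MvPowerSeries (Fin 2) R} {j : ℕ},
      ((a * w 0 + b * w 1 + 1 + j : ℕ) : ℕ∞) ≤ z.weightedOrder w →
      ((b * w 1 + 1 + j : ℕ) : ℕ∞) ≤ (divX a z).weightedOrder w := fun hz =>
    le_weightedOrder_divX (by convert hz using 2; ring)
  have hY : ∀ {z : MvPowerSeries (Fin 2) R} {j : ℕ},
      ((a * w 0 + b * w 1 + 1 + j : ℕ) : ℕ∞) ≤ z.weightedOrder w →
      ((a * w 0 + 1 + j : ℕ) : ℕ∞) ≤ (divY a b z).weightedOrder w := fun hz =>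
    le_weightedOrder_divY (by convert hz using 2; ring)
  have hmul : ∀ {u v : MvPowerSeries (Fin 2) R} {m n k : ℕ},
      (m : ℕ∞) ≤ u.weightedOrder w → (n : ℕ∞) ≤ v.weightedOrder w → k ≤ m + n →
      (k : ℕ∞) ≤ (u * v).weightedOrder w := fun hu hv hk =>
    le_trans (by exact_mod_cast hk) ((add_le_add hu hv).trans (le_weightedOrder_mul w))
  obtain ⟨z, hz, hfix⟩ := exists_fixedPoint_of_weightedOrder (w := w)
    (N := a * w 0 + b * w 1 + 1)
    (fun z => f - X 0 ^ a * X 1 ^ b - divY a b z * divX a z)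
    (fun z hz => le_weightedOrder_sub h
      (hmul (hY (j := 0) hz) (hX (j := 0) hz) (by omega)))
    (fun z z' j hz hz' hj => by
      have key : f - X 0 ^ a * X 1 ^ b - divY a b z * divX a z -
          (f - X 0 ^ a * X 1 ^ b - divY a b z' * divX a z') =
          divY a b z' * divX a (z' - z) - divY a b (z - z') * divX a z := by
        rw [divX_sub, divY_sub]; ring
      rw [key]
      have hj' := hj
      rw [← weightedOrder_neg, neg_sub] at hj'
      exact le_weightedOrder_sub (hmul (hY (j := 0) hz') (hX hj') (by omega))
        (hmul (hY hj) (hX (j := 0) hz) (by omega)))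
  refine ⟨divY a b z, divX a z, ?_, hY (j := 0) hz, hX (j := 0) hz⟩
  have hdec := X_pow_mul_divX_add_X_pow_mul_divY hz
  linear_combination hfix - hdec

end Splitting

end MvPowerSeries

namespace PlaneCurveNote

section Lattice

/-- A set of lattice points which has a point below the segment joining `(m, 0)` to `(0, n)`, but
none of them on the axes, has a vertex off the axes. -/
theorem exists_vertex {S : Set (ℕ × ℕ)} {m n : ℕ} (hx : ∀ a, (a, 0) ∈ S → m ≤ a)
    (hy : ∀ b, (0, b) ∈ S → n ≤ b) {p : ℕ × ℕ} (hp : p ∈ S)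
    (hlt : n * p.1 + m * p.2 < m * n) :
    ∃ V ∈ S, 0 < V.1 ∧ 0 < V.2 ∧ ∃ w : Fin 2 → ℕ, ∀ q ∈ S, q ≠ V →
      V.1 * w 0 + V.2 * w 1 < q.1 * w 0 + q.2 * w 1 := by
  obtain ⟨V, hV, hmin⟩ := WellFounded.has_min
    (InvImage.wf (fun q : ℕ × ℕ => toLex (n * q.1 + m * q.2, q.1)) wellFounded_lt) S ⟨p, hp⟩
  have hmin' : ∀ q ∈ S, n * V.1 + m * V.2 < n * q.1 + m * q.2 ∨
      n * V.1 + m * V.2 = n * q.1 + m * q.2 ∧ V.1 ≤ q.1 := by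
    intro q hq
    have := hmin q hq
    simp only [InvImage, Prod.Lex.toLex_lt_toLex, not_or, not_and, not_lt] at this
    rcases this.1.lt_or_eq with h | h
    · exact Or.inl h
    · exact Or.inr ⟨h, this.2 h.symm⟩
  have hVlt : n * V.1 + m * V.2 < m * n := by
    rcases hmin' p hp with h | h <;> omega
  have hm : 0 < m := Nat.pos_of_ne_zero fun h => by simp [h] at hVlt
  obtain ⟨v₁, v₂⟩ := V
  dsimp only at hmin' hVlt
  refine ⟨(v₁, v₂), hV, ?_, ?_, ![n * (v₁ + 1) + 1, m * (v₁ + 1)], ?_⟩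
  · refine Nat.pos_of_ne_zero ?_
    rintro rfl
    have := Nat.mul_le_mul_left m (hy _ hV)
    omega
  · refine Nat.pos_of_ne_zero ?_
    rintro rfl
    have := Nat.mul_le_mul_left n (hx _ hV)
    rw [mul_comm m n] at hVlt
    omega
  · rintro ⟨q₁, q₂⟩ hq hne
    simp only [Matrix.cons_val_zero, Matrix.cons_val_one]
    rcases hmin' _ hq with h | ⟨h, h'⟩
    · dsimp only at h
      have := Nat.mul_le_mul_left (v₁ + 1) (Nat.succ_le_of_lt h)
      nlinarith
    · dsimp only at h h'
      rcases h'.lt_or_eq with h'' | rfl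
      · nlinarith
      · exact absurd (by rw [Nat.eq_of_mul_eq_mul_left hm (Nat.add_left_cancel h)]) hne

end Lattice

section Axes

variable {K : Type u} [Field K]

theorem mem_supp_of_coeff_ne_zero {f : PS K} {d : Fin 2 →₀ ℕ}
    (h : MvPowerSeries.coeff d f ≠ 0) : (d 0, d 1) ∈ supp K f := by
  have hd : Finsupp.single 0 (d 0) + Finsupp.single 1 (d 1) = d := by
    ext i; fin_cases i <;> simp
  simpa only [supp, coef, Set.mem_ofPred_eq, hd] using h

theorem exists_add_eq_of_mem_supp_mul {f g : PS K} {p : ℕ × ℕ} (hp : p ∈ supp K (f * g)) :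
    ∃ q ∈ supp K f, ∃ r ∈ supp K g, q + r = p := by
  simp only [supp, coef, Set.mem_ofPred_eq, MvPowerSeries.coeff_mul] at hp
  obtain ⟨⟨d, e⟩, hde, hne⟩ := Finset.exists_ne_zero_of_sum_ne_zero hp
  refine ⟨_, mem_supp_of_coeff_ne_zero (left_ne_zero_of_mul hne), _,
    mem_supp_of_coeff_ne_zero (right_ne_zero_of_mul hne), ?_⟩
  rw [Finset.HasAntidiagonal.mem_antidiagonal] at hde
  have h0 := DFunLike.congr_fun hde 0
  have h1 := DFunLike.congr_fun hde 1
  ext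
  · simpa using h0
  · simpa using h1

/-- The restriction of `f` to the coordinate axis of index `i`, namely `f(x, 0)` or `f(0, y)`. -/
def axis (i : Fin 2) (f : PS K) : PowerSeries K :=
  PowerSeries.mk fun n => MvPowerSeries.coeff (Finsupp.single i n) f

theorem axis_mul (i : Fin 2) (f g : PS K) : axis i (f * g) = axis i f * axis i g := by
  ext n
  simp [axis, PowerSeries.coeff_mul, MvPowerSeries.coeff_mul, Finsupp.antidiagonal_single,
    Finset.sum_map]

theorem mem_supp_left_iff {f : PS K} {a : ℕ} :
    (a, 0) ∈ supp K f ↔ PowerSeries.coeff a (axis 0 f) ≠ 0 := by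
  simp [supp, coef, axis]

theorem mem_supp_right_iff {f : PS K} {b : ℕ} :
    (0, b) ∈ supp K f ↔ PowerSeries.coeff b (axis 1 f) ≠ 0 := by
  simp [supp, coef, axis]

theorem convenient_iff {f : PS K} : Convenient K f ↔ axis 0 f ≠ 0 ∧ axis 1 f ≠ 0 := by
  simp only [Convenient, mem_supp_left_iff, mem_supp_right_iff,
    PowerSeries.exists_coeff_ne_zero_iff_ne_zero]

theorem convenient_mul_iff {f g : PS K} :
    Convenient K (f * g) ↔ Convenient K f ∧ Convenient K g := by
  simp only [convenient_iff, axis_mul, mul_ne_zero_iff]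
  tauto

theorem sInf_coeff_ne_zero {φ : PowerSeries K} (h : φ ≠ 0) :
    sInf {n | PowerSeries.coeff n φ ≠ 0} = φ.order.toNat := by
  refine le_antisymm (Nat.sInf_le (PowerSeries.coeff_order h)) ?_
  exact ENat.toNat_le_of_le_natCast
    (PowerSeries.order_le _ (Nat.sInf_mem (s := {n | PowerSeries.coeff n φ ≠ 0})
      ⟨_, PowerSeries.coeff_order h⟩))

theorem ordX_eq {f : PS K} (hf : Convenient K f) : ordX K f = (axis 0 f).order.toNat := by
  simp only [ordX, mem_supp_left_iff, sInf_coeff_ne_zero (convenient_iff.1 hf).1]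

theorem ordY_eq {f : PS K} (hf : Convenient K f) : ordY K f = (axis 1 f).order.toNat := by
  simp only [ordY, mem_supp_right_iff, sInf_coeff_ne_zero (convenient_iff.1 hf).2]

theorem ordX_mul {f g : PS K} (hf : Convenient K f) (hg : Convenient K g) :
    ordX K (f * g) = ordX K f + ordX K g := by
  rw [ordX_eq hf, ordX_eq hg, ordX_eq (convenient_mul_iff.2 ⟨hf, hg⟩), axis_mul,
    PowerSeries.order_mul, ENat.toNat_add (PowerSeries.order_eq_top.not.2 (convenient_iff.1 hf).1)
      (PowerSeries.order_eq_top.not.2 (convenient_iff.1 hg).1)]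

theorem ordY_mul {f g : PS K} (hf : Convenient K f) (hg : Convenient K g) :
    ordY K (f * g) = ordY K f + ordY K g := by
  rw [ordY_eq hf, ordY_eq hg, ordY_eq (convenient_mul_iff.2 ⟨hf, hg⟩), axis_mul,
    PowerSeries.order_mul, ENat.toNat_add (PowerSeries.order_eq_top.not.2 (convenient_iff.1 hf).2)
      (PowerSeries.order_eq_top.not.2 (convenient_iff.1 hg).2)]

theorem ordX_mem_supp {f : PS K} (hf : Convenient K f) : (ordX K f, 0) ∈ supp K f :=
  Nat.sInf_mem hf.1

theorem ordY_mem_supp {f : PS K} (hf : Convenient K f) : (0, ordY K f) ∈ supp K f :=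
  Nat.sInf_mem hf.2

theorem zero_notMem_supp {f : PS K}
    (h0 : MvPowerSeries.constantCoeff (σ := Fin 2) (R := K) f = 0) : (0, 0) ∉ supp K f := by
  simpa [supp, coef] using h0

theorem ordX_pos {f : PS K} (hf : Convenient K f)
    (h0 : MvPowerSeries.constantCoeff (σ := Fin 2) (R := K) f = 0) : 0 < ordX K f :=
  Nat.pos_of_ne_zero fun h => zero_notMem_supp h0 (h ▸ ordX_mem_supp hf)

theorem ordY_pos {f : PS K} (hf : Convenient K f)
    (h0 : MvPowerSeries.constantCoeff (σ := Fin 2) (R := K) f = 0) : 0 < ordY K f :=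
  Nat.pos_of_ne_zero fun h => zero_notMem_supp h0 (h ▸ ordY_mem_supp hf)

end Axes

section Elementary

variable {K : Type u} [Field K]

/-- `f` is a convenient non-unit whose support lies on or above the segment joining the points
`(ord f(x, 0), 0)` and `(0, ord f(0, y))`. -/
structure AboveSegment (f : PS K) : Prop where
  convenient : Convenient K f
  ordX_pos : 0 < ordX K f
  ordY_pos : 0 < ordY K f
  le : ∀ p ∈ supp K f, ordX K f * ordY K f ≤ ordY K f * p.1 + ordX K f * p.2

theorem AboveSegment.elementary {f : PS K} (hf : AboveSegment f) : Elementary K f := by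
  obtain ⟨hconv, hm, hn, hle⟩ := hf
  have hX := ordX_mem_supp hconv
  have hY := ordY_mem_supp hconv
  generalize ordX K f = m at *
  generalize ordY K f = n at *
  refine ⟨hconv, ⟨(0, n), (m, 0), hm, hn⟩, Set.eq_singleton_iff_unique_mem.2 ⟨?_, ?_⟩⟩
  · refine ⟨hY, hX, (n, m), hn, hm, by simp [mul_comm], fun p hp => by simpa using hle p hp, ?_⟩
    intro p hp h
    refine ⟨Nat.zero_le _, le_of_mul_le_mul_left (a := n) ?_ hn⟩
    simp only at h ⊢
    rw [mul_zero, zero_add, mul_comm m n] at h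
    omega
  · rintro ⟨⟨a, b⟩, ⟨c, d⟩, hac, hdb⟩ ⟨hA, hB, ⟨w₁, w₂⟩, hw₁, hw₂, hAB, hmin, hmax⟩
    dsimp only at *
    have hAX := hmin _ hX
    have hAY := hmin _ hY
    have hA' := hle _ hA
    have hB' := hle _ hB
    have hw : w₁ * m = w₂ * n := by
      refine le_antisymm (le_of_mul_le_mul_right (a := c) ?_ (by omega))
        (le_of_mul_le_mul_right (a := b) ?_ (by omega))
      · have h₁ := Nat.mul_le_mul_left w₂ hB'
        have h₂ := Nat.mul_le_mul_left m (hAB.trans_le hAY)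
        linarith
      · have h₁ := Nat.mul_le_mul_left w₁ hA'
        have h₂ := Nat.mul_le_mul_left n hAX
        linarith
    have hA₂ : w₁ * a + w₂ * b = w₁ * m := by
      refine le_antisymm hAX (le_of_mul_le_mul_left (a := n) ?_ hn)
      linear_combination w₁ * hA' + b * hw
    have h₁ := hmax _ hX (by simpa using hA₂.symm)
    have h₂ := hmax _ hY (by simp only; omega)
    simp only at h₁ h₂ hAX hAY
    obtain rfl : a = 0 := by omega
    have hc : c ≤ m := le_of_mul_le_mul_left (a := w₁) (by omega) hw₁
    obtain rfl : c = m := le_antisymm hc h₁.2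
    have hb : b = n := Nat.eq_of_mul_eq_mul_left hw₂ (by omega)
    have hd : d = 0 := by
      rcases Nat.eq_zero_or_pos d with h | h
      · exact h
      · have := Nat.mul_pos hw₂ h
        omega
    subst hb hd
    rfl

theorem AboveSegment.mul {f g : PS K} (hf : AboveSegment f) (hg : AboveSegment g)
    (h : ordX K f * ordY K g = ordX K g * ordY K f) : AboveSegment (f * g) := by
  refine ⟨convenient_mul_iff.2 ⟨hf.convenient, hg.convenient⟩, ?_, ?_, ?_⟩
  · rw [ordX_mul hf.convenient hg.convenient]
    exact Nat.add_pos_left hf.ordX_pos _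
  · rw [ordY_mul hf.convenient hg.convenient]
    exact Nat.add_pos_left hf.ordY_pos _
  · intro p hp
    rw [ordX_mul hf.convenient hg.convenient, ordY_mul hf.convenient hg.convenient]
    obtain ⟨q, hq, r, hr, rfl⟩ := exists_add_eq_of_mem_supp_mul hp
    have hq' := hf.le q hq
    have hr' := hg.le r hr
    have hm := hf.ordX_pos
    have hm' := hg.ordX_pos
    simp only [Prod.fst_add, Prod.snd_add]
    generalize ordX K f = m at *
    generalize ordY K f = n at *
    generalize ordX K g = m' at *
    generalize ordY K g = n' at *
    have h₁ : m' * n ≤ n' * q.1 + m' * q.2 := by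
      refine le_of_mul_le_mul_left (a := m) ?_ hm
      linear_combination m' * hq' + h.symm * q.1
    have h₂ : m * n' ≤ n * r.1 + m * r.2 := by
      refine le_of_mul_le_mul_left (a := m') ?_ hm'
      linear_combination m * hr' + h * r.1
    nlinarith

/-- The inclination `I(f) = m / n` of a series of bidegree `(m, n)`. -/
def inclination (f : PS K) : ℚ := (ordX K f : ℚ) / (ordY K f : ℚ)

theorem AboveSegment.mul_of_inclination_eq {f g : PS K} (hf : AboveSegment f)
    (hg : AboveSegment g) (h : inclination f = inclination g) :
    AboveSegment (f * g) ∧ inclination (f * g) = inclination f := by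
  have hn : (ordY K f : ℚ) ≠ 0 := by exact_mod_cast hf.ordY_pos.ne'
  have hn' : (ordY K g : ℚ) ≠ 0 := by exact_mod_cast hg.ordY_pos.ne'
  have hfg : (ordX K f * ordY K g : ℚ) = ordX K g * ordY K f := (div_eq_div_iff hn hn').1 h
  refine ⟨hf.mul hg (by exact_mod_cast hfg), ?_⟩
  have hs : (ordY K f + ordY K g : ℚ) ≠ 0 := by
    exact_mod_cast (Nat.add_pos_left hf.ordY_pos _).ne'
  rw [inclination, inclination, ordX_mul hf.convenient hg.convenient,
    ordY_mul hf.convenient hg.convenient]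
  push_cast
  rw [div_eq_div_iff hs hn]
  linear_combination -hfg

end Elementary

section Factorization

variable {K : Type u} [Field K]

/-- A convenient non-unit whose support is not above the segment joining its points on the axes
is a product of two non-units. -/
theorem exists_mul_of_not_aboveSegment {f : PS K} (hconv : Convenient K f)
    (h0 : MvPowerSeries.constantCoeff (σ := Fin 2) (R := K) f = 0) (hf : ¬ AboveSegment f) :
    ∃ g h : PS K, f = g * h ∧ MvPowerSeries.constantCoeff (σ := Fin 2) (R := K) g = 0 ∧
      MvPowerSeries.constantCoeff (σ := Fin 2) (R := K) h = 0 := by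
  obtain ⟨p, hp, hlt⟩ : ∃ p ∈ supp K f,
      ordY K f * p.1 + ordX K f * p.2 < ordX K f * ordY K f := by
    by_contra! h
    exact hf ⟨hconv, ordX_pos hconv h0, ordY_pos hconv h0, h⟩
  obtain ⟨⟨a, b⟩, hV, ha, hb, w, hw⟩ := exists_vertex (fun _ h => Nat.sInf_le h)
    (fun _ h => Nat.sInf_le h) hp hlt
  set c : K := coef K f (a, b)
  have hc0 : c ≠ 0 := hV
  obtain ⟨u, v, huv, hu, hv⟩ := MvPowerSeries.exists_mul_eq_of_weightedOrder
    (w := w) (a := a) (b := b) (f := MvPowerSeries.C c⁻¹ * f) (by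
      refine MvPowerSeries.nat_le_weightedOrder w fun d hd => ?_
      rw [MvPowerSeries.weight_fin_two] at hd
      rw [MvPowerSeries.X_pow_eq, MvPowerSeries.X_pow_eq, MvPowerSeries.monomial_mul_monomial,
        map_sub, MvPowerSeries.coeff_C_mul, MvPowerSeries.coeff_monomial]
      split_ifs with hdV
      · rw [hdV, ← show c = MvPowerSeries.coeff _ f from rfl, inv_mul_cancel₀ hc0, one_mul,
          sub_self]
      · rw [sub_zero]
        by_contra hne
        have hmem := mem_supp_of_coeff_ne_zero (right_ne_zero_of_mul hne)
        refine absurd (hw _ hmem ?_) (by simp only; omega)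
        intro h
        simp only [Prod.mk.injEq] at h
        apply hdV
        ext i
        fin_cases i <;> simp [h.1, h.2])
  have hconst : ∀ {u : PS K} {k : ℕ}, ((k + 1 : ℕ) : ℕ∞) ≤ u.weightedOrder w →
      MvPowerSeries.constantCoeff (σ := Fin 2) (R := K) u = 0 := fun {u k} h => by
    rw [← MvPowerSeries.coeff_zero_eq_constantCoeff_apply]
    exact MvPowerSeries.coeff_eq_zero_of_lt_weightedOrder w
      (lt_of_lt_of_le (by simp) h)
  refine ⟨MvPowerSeries.X 0 ^ a + u, MvPowerSeries.C c * (MvPowerSeries.X 1 ^ b + v), ?_, ?_, ?_⟩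
  · rw [mul_left_comm, ← huv, ← mul_assoc, ← map_mul, mul_inv_cancel₀ hc0, map_one, one_mul]
  · simp [hconst hu, ha.ne']
  · simp [hconst hv, hb.ne']

/-- `f` is a product of series above their segments, with pairwise distinct inclinations. -/
def IsProdAboveSegment (f : PS K) : Prop :=
  ∃ (F : Finset ℚ) (G : ℚ → PS K), f = ∏ q ∈ F, G q ∧
    ∀ q ∈ F, AboveSegment (G q) ∧ inclination (G q) = q

theorem IsProdAboveSegment.mul {f g : PS K} (hf : IsProdAboveSegment f)
    (hg : IsProdAboveSegment g) : IsProdAboveSegment (f * g) := by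
  obtain ⟨F₁, G₁, rfl, h₁⟩ := hf
  obtain ⟨F₂, G₂, rfl, h₂⟩ := hg
  refine ⟨F₁ ∪ F₂, fun q => (if q ∈ F₁ then G₁ q else 1) * (if q ∈ F₂ then G₂ q else 1),
    ?_, fun q hq => ?_⟩
  · rw [Finset.prod_mul_distrib, Finset.prod_ite_mem, Finset.prod_ite_mem,
      Finset.union_inter_cancel_left, Finset.union_inter_cancel_right]
  · by_cases hq₁ : q ∈ F₁ <;> by_cases hq₂ : q ∈ F₂
    · simp only [hq₁, hq₂, if_true]
      have := (h₁ q hq₁).1.mul_of_inclination_eq (h₂ q hq₂).1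
        ((h₁ q hq₁).2.trans (h₂ q hq₂).2.symm)
      exact ⟨this.1, this.2.trans (h₁ q hq₁).2⟩
    · simpa [hq₁, hq₂] using h₁ q hq₁
    · simpa [hq₁, hq₂] using h₂ q hq₂
    · simp [hq₁, hq₂] at hq

theorem isProdAboveSegment_of_convenient {f : PS K} (hconv : Convenient K f)
    (h0 : MvPowerSeries.constantCoeff (σ := Fin 2) (R := K) f = 0) : IsProdAboveSegment f := by
  induction hk : ordX K f using Nat.strong_induction_on generalizing f with
  | _ k ih =>
    by_cases hf : AboveSegment f
    · exact ⟨{inclination f}, fun _ => f, by simp, by simp [hf]⟩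
    · obtain ⟨g, h, rfl, hg0, hh0⟩ := exists_mul_of_not_aboveSegment hconv h0 hf
      obtain ⟨hg, hh⟩ := convenient_mul_iff.1 hconv
      have hgpos := ordX_pos hg hg0
      have hhpos := ordX_pos hh hh0
      rw [ordX_mul hg hh] at hk
      exact (ih _ (by omega) hg hg0 rfl).mul (ih _ (by omega) hh hh0 rfl)

end Factorization

theorem convenient_eq_prod_elementary (K : Type u) [Field K] [IsAlgClosed K]
    (f : PS K) (hconv : Convenient K f)
    (h0 : MvPowerSeries.constantCoeff (σ := Fin 2) (R := K) f = 0) :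
    ∃ (s : ℕ) (g : Fin s → PS K), f = ∏ i, g i ∧ (∀ i, Elementary K (g i)) ∧
      ∀ i j, i < j →
        (ordX K (g i) : ℚ) / (ordY K (g i) : ℚ) < (ordX K (g j) : ℚ) / (ordY K (g j) : ℚ) := by
  obtain ⟨F, G, rfl, hG⟩ := isProdAboveSegment_of_convenient hconv h0
  let e := F.orderIsoOfFin rfl
  refine ⟨F.card, fun i => G (e i), ?_, fun i => (hG _ (e i).2).1.elementary, fun i j hij => ?_⟩
  · rw [← Finset.prod_coe_sort]
    exact (Equiv.prod_comp e.toEquiv fun q : F => G q).symm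
  · have hlt : ((e i : F) : ℚ) < e j := e.strictMono hij
    rwa [← (hG _ (e i).2).2, ← (hG _ (e j).2).2] at hlt

end PlaneCurveNote
end
end

section
/- Let K be an algebraically closed field, f ∈ K[[x,y]] an elementary power series with bideg(f) = (m,n), and f = f₁⋯f_r its factorization into irreducible factors with bideg(f_i) = (m_i, n_i). Put d = gcd(m,n) and d_i = gcd(m_i, n_i). Then: (1) m_i/d_i = m/d and n_i/d_i = n/d for every i ∈ {1,…,r}; (2) Σ_{i=1}^{r} d_i = d. Moreover, r ≤ d, with equality if f is non-degenerate. -/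
/-!
Common definitions for formalizing "A note on the plane curve singularities in
positive characteristic" by E. García Barroso and A. Płoski.

We work with the ring `K[[x,y]] := MvPowerSeries (Fin 2) K`, where `x` is the
variable of index `0` and `y` the variable of index `1`.
-/

open scoped Classical

noncomputable section

universe u

namespace PlaneCurveNote

variable (K : Type u) [Field K]

section WeightedSubstitution

variable {K : Type u} [Field K]

open Polynomial in
/-- The images of the variables under `x ↦ T^a`, `y ↦ s T^b`. -/
def weightedVars (K : Type u) [Field K] (a b : ℕ) : Fin 2 → MvPowerSeries Unit K[X] :=
  ![(PowerSeries.X ^ a : PowerSeries K[X]),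
    (PowerSeries.C X * PowerSeries.X ^ b : PowerSeries K[X])]

lemma hasSubst_weightedVars {a b : ℕ} (ha : 0 < a) (hb : 0 < b) :
    MvPowerSeries.HasSubst (weightedVars K a b) := by
  apply MvPowerSeries.hasSubst_of_constantCoeff_zero
  intro s
  fin_cases s
  · change PowerSeries.constantCoeff (R := Polynomial K) (PowerSeries.X ^ a) = 0
    simp [ha.ne']
  · change PowerSeries.constantCoeff (R := Polynomial K)
      (PowerSeries.C Polynomial.X * PowerSeries.X ^ b) = 0
    simp [hb.ne']

open Polynomial in
/-- The ring homomorphism `f(x,y) ↦ f(T^a, s T^b)` from `K[[x,y]]` to `K[s][[T]]`. The coefficient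
of `T^k` is the dehomogenization of the part of `f` of weighted degree `k`. -/
def weightedSubst (K : Type u) [Field K] {a b : ℕ} (ha : 0 < a) (hb : 0 < b) :
    PS K →ₐ[K] PowerSeries K[X] :=
  MvPowerSeries.substAlgHom (hasSubst_weightedVars ha hb)

lemma weightedVars_prod (a b : ℕ) (d : Fin 2 →₀ ℕ) :
    (d.prod fun s e => weightedVars K a b s ^ e) =
      PowerSeries.monomial (R := Polynomial K) (a * d 0 + b * d 1) (Polynomial.X ^ d 1) := by
  rw [Finsupp.prod_fintype _ _ (by simp), Fin.prod_univ_two]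
  change ((PowerSeries.X ^ a : PowerSeries (Polynomial K)) ^ d 0 *
    (PowerSeries.C Polynomial.X * PowerSeries.X ^ b : PowerSeries (Polynomial K)) ^ d 1) = _
  rw [PowerSeries.monomial_eq_C_mul_X_pow, map_pow]
  ring

lemma coeff_coeff_weightedSubst {a b : ℕ} (ha : 0 < a) (hb : 0 < b) (f : PS K) (k j : ℕ) :
    (PowerSeries.coeff k (weightedSubst K ha hb f)).coeff j =
      ∑ᶠ d : Fin 2 →₀ ℕ, if k = a * d 0 + b * d 1 ∧ j = d 1 then
        MvPowerSeries.coeff d f else 0 := by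
  have h := MvPowerSeries.coeff_subst (hasSubst_weightedVars (K := K) ha hb) f
    (Finsupp.single () k)
  have hfin := MvPowerSeries.coeff_subst_finite (hasSubst_weightedVars (K := K) ha hb) f
    (Finsupp.single () k)
  rw [weightedSubst, MvPowerSeries.substAlgHom_apply]
  change (MvPowerSeries.coeff (Finsupp.single () k)
    (MvPowerSeries.subst (weightedVars K a b) f)).coeff j = _
  rw [h, ← Polynomial.lcoeff_apply, ← LinearMap.toAddMonoidHom_coe,
    AddMonoidHom.map_finsum _ hfin]
  refine finsum_congr fun d => ?_
  rw [weightedVars_prod]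
  change (MvPowerSeries.coeff d f • PowerSeries.coeff k
    (PowerSeries.monomial (R := Polynomial K) _ (Polynomial.X ^ d 1))).coeff j = _
  rw [PowerSeries.coeff_monomial, Polynomial.coeff_smul]
  split_ifs <;> simp_all [Polynomial.coeff_X_pow]

lemma coef_eq_coeff (f : PS K) (d : Fin 2 →₀ ℕ) :
    coef K f (d 0, d 1) = MvPowerSeries.coeff d f := by
  have : d = Finsupp.single 0 (d 0) + Finsupp.single 1 (d 1) := by
    ext i; fin_cases i <;> simp
  rw [coef, ← this]

lemma ext_coef {f g : PS K} (h : ∀ i j, coef K f (i, j) = coef K g (i, j)) : f = g := by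
  ext d
  rw [← coef_eq_coeff, ← coef_eq_coeff, h]

lemma coef_ofCoef (c : ℕ × ℕ → K) (p : ℕ × ℕ) : coef K (ofCoef K c) p = c p := by
  change c _ = _
  simp

/-- The coefficient of `s^j T^(a i + b j)` in `f(T^a, s T^b)`. -/
lemma coeff_weightedSubst_of_eq {a b : ℕ} (ha : 0 < a) (hb : 0 < b) (f : PS K) {i j k : ℕ}
    (hk : a * i + b * j = k) :
    (PowerSeries.coeff k (weightedSubst K ha hb f)).coeff j = coef K f (i, j) := by
  rw [coeff_coeff_weightedSubst, finsum_eq_single _ (Finsupp.single 0 i + Finsupp.single 1 j)]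
  · simp [coef, hk.symm]
  · intro d hd
    rw [if_neg]
    rintro ⟨h1, h2⟩
    apply hd
    ext s
    have : i = d 0 := Nat.eq_of_mul_eq_mul_left ha (by subst h2; omega)
    fin_cases s <;> simp [this, h2]

lemma exists_of_coeff_weightedSubst_ne_zero {a b : ℕ} (ha : 0 < a) (hb : 0 < b) {f : PS K}
    {j k : ℕ} (h : (PowerSeries.coeff k (weightedSubst K ha hb f)).coeff j ≠ 0) :
    ∃ i, a * i + b * j = k := by
  rw [coeff_coeff_weightedSubst] at h
  obtain ⟨d, hd⟩ : ∃ d : Fin 2 →₀ ℕ, (if k = a * d 0 + b * d 1 ∧ j = d 1 then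
      MvPowerSeries.coeff d f else 0) ≠ 0 := by
    by_contra! hall
    exact h (by simp only [hall, finsum_zero])
  have := (ite_ne_right_iff.mp hd).1
  exact ⟨d 0, by rw [this.1, this.2]⟩

lemma weightedSubst_injective {a b : ℕ} (ha : 0 < a) (hb : 0 < b) :
    Function.Injective (weightedSubst K ha hb) := by
  intro f g h
  refine ext_coef fun i j => ?_
  rw [← coeff_weightedSubst_of_eq ha hb f rfl, h, coeff_weightedSubst_of_eq ha hb g rfl]

open Polynomial in
/-- The space of polynomials in `s` which are dehomogenizations of forms in `x, y` of weighted
degree `k`, where `x, y` have weights `a, b`. -/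
def formSpace (K : Type u) [Field K] (a b k : ℕ) : Submodule K K[X] where
  carrier := {P | ∀ j, P.coeff j ≠ 0 → ∃ i, a * i + b * j = k}
  add_mem' {P Q} hP hQ j hj := by
    by_cases h : P.coeff j = 0
    · exact hQ j (by simpa [h] using hj)
    · exact hP j h
  zero_mem' := by simp
  smul_mem' c P hP j hj := hP j (by rw [coeff_smul] at hj; exact right_ne_zero_of_smul hj)

lemma mul_mem_formSpace {a b k l : ℕ} {P Q : Polynomial K} (hP : P ∈ formSpace K a b k)
    (hQ : Q ∈ formSpace K a b l) : P * Q ∈ formSpace K a b (k + l) := by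
  intro j hj
  rw [Polynomial.coeff_mul] at hj
  obtain ⟨⟨u, v⟩, huv, hne⟩ := Finset.exists_ne_zero_of_sum_ne_zero hj
  rw [Finset.HasAntidiagonal.mem_antidiagonal] at huv
  obtain ⟨i, hi⟩ := hP u (left_ne_zero_of_mul hne)
  obtain ⟨i', hi'⟩ := hQ v (right_ne_zero_of_mul hne)
  exact ⟨i + i', by rw [← huv, ← hi, ← hi']; ring⟩

lemma coeff_weightedSubst_mem {a b : ℕ} (ha : 0 < a) (hb : 0 < b) (f : PS K) (k : ℕ) :
    PowerSeries.coeff k (weightedSubst K ha hb f) ∈ formSpace K a b k :=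
  fun _ h => exists_of_coeff_weightedSubst_ne_zero ha hb h

lemma exists_weightedSubst_eq {a b : ℕ} (ha : 0 < a) (hb : 0 < b)
    {F : PowerSeries (Polynomial K)} (hF : ∀ k, PowerSeries.coeff k F ∈ formSpace K a b k) :
    ∃ f, weightedSubst K ha hb f = F := by
  refine ⟨ofCoef K fun p => (PowerSeries.coeff (a * p.1 + b * p.2) F).coeff p.2, ?_⟩
  ext k j
  by_cases h : ∃ i, a * i + b * j = k
  · obtain ⟨i, rfl⟩ := h
    rw [coeff_weightedSubst_of_eq ha hb _ rfl, coef_ofCoef]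
  · rw [not_imp_comm.mp (hF k j) h, not_imp_comm.mp (coeff_weightedSubst_mem ha hb _ k j) h]

end WeightedSubstitution

section Lifting

/-- Sequences can be defined by recursion on all earlier values. -/
lemma exists_seq_of_step {α : Type*} [Nonempty α] (P : ℕ → (ℕ → α) → α → Prop)
    (hcongr : ∀ n u v x, (∀ i < n, u i = v i) → P n u x → P n v x)
    (hP : ∀ n u, (∀ i < n, P i u (u i)) → ∃ x, P n u x) : ∃ u : ℕ → α, ∀ n, P n u (u n) := by
  have := Classical.inhabited_of_nonempty ‹Nonempty α›
  choose! step hstep using hP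
  let u : ℕ → α := fun n => Nat.strongRec (motive := fun _ => α)
    (fun n ih => step n fun i => if h : i < n then ih i h else default) n
  have hu : ∀ n, u n = step n fun i => if i < n then u i else default := by
    intro n
    simp only [u]
    rw [Nat.strongRec_eq]
    simp only [dite_eq_ite]
  refine ⟨u, fun n => ?_⟩
  induction n using Nat.strong_induction_on with
  | _ n ih =>
    refine hcongr n (fun i => if i < n then u i else default) u _ (fun i hi => if_pos hi) ?_
    rw [hu n]
    refine hstep n _ fun i hi => ?_
    rw [if_pos hi]
    exact hcongr i u _ _ (fun l hl => (if_pos (hl.trans hi)).symm) (ih i hi)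

/-- A graded form of Hensel's lemma: a factorization of the leading coefficient of a power series
lifts to the series, provided that the linearized equations are solvable in all degrees. -/
lemma exists_lift_mul {R A : Type*} [CommRing A] [CommRing R] [Algebra R A]
    (V : ℕ → Submodule R A)
    (hV : ∀ k l P Q, P ∈ V k → Q ∈ V l → P * Q ∈ V (k + l)) {k l : ℕ} {G H : A}
    (hG : G ∈ V k) (hH : H ∈ V l)
    (hsolve : ∀ e, 0 < e → ∀ F ∈ V (k + l + e),
      ∃ u ∈ V (k + e), ∃ v ∈ V (l + e), F = G * v + u * H)
    (h : PowerSeries A) (hmem : ∀ e, PowerSeries.coeff e h ∈ V (k + l + e))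
    (h0 : PowerSeries.coeff 0 h = G * H) :
    ∃ g g' : PowerSeries A, (∀ e, PowerSeries.coeff e g ∈ V (k + e)) ∧
      (∀ e, PowerSeries.coeff e g' ∈ V (l + e)) ∧ h = g * g' := by
  let P : ℕ → (ℕ → A × A) → A × A → Prop := fun n w x =>
    x.1 ∈ V (k + n) ∧ x.2 ∈ V (l + n) ∧ (n = 0 → x = (G, H)) ∧
      (0 < n → PowerSeries.coeff n h = (∑ i ∈ Finset.range (n - 1),
        (w (i + 1)).1 * (w (n - 1 - i)).2) + (G * x.2 + x.1 * H))
  obtain ⟨w, hw⟩ := exists_seq_of_step P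
    (by
      rintro n u v x huv ⟨h1, h2, h3, h4⟩
      refine ⟨h1, h2, h3, fun hn => ?_⟩
      rw [h4 hn]
      congr 1
      refine Finset.sum_congr rfl fun i hi => ?_
      rw [Finset.mem_range] at hi
      rw [huv _ (by omega), huv _ (by omega)])
    (by
      intro n w hw
      rcases Nat.eq_zero_or_pos n with rfl | hn
      · exact ⟨(G, H), hG, hH, fun _ => rfl, fun h => absurd h (lt_irrefl _)⟩
      obtain ⟨u, hu, v, hv, huv⟩ := hsolve n hn
        (PowerSeries.coeff n h - ∑ i ∈ Finset.range (n - 1),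
          (w (i + 1)).1 * (w (n - 1 - i)).2) (by
          refine Submodule.sub_mem _ (hmem n) (Submodule.sum_mem _ fun i hi => ?_)
          rw [Finset.mem_range] at hi
          have := hV _ _ _ _ (hw (i + 1) (by omega)).1 (hw (n - 1 - i) (by omega)).2.1
          rwa [show k + (i + 1) + (l + (n - 1 - i)) = k + l + n by omega] at this)
      exact ⟨(u, v), hu, hv, fun h => absurd h hn.ne', fun _ => by rw [← huv]; ring⟩)
  refine ⟨PowerSeries.mk fun n => (w n).1, PowerSeries.mk fun n => (w n).2,
    fun e => by simpa using (hw e).1, fun e => by simpa using (hw e).2.1, ?_⟩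
  have hw0 : w 0 = (G, H) := (hw 0).2.2.1 rfl
  ext n
  rw [PowerSeries.coeff_mul]
  simp only [PowerSeries.coeff_mk]
  rw [Finset.Nat.sum_antidiagonal_eq_sum_range_succ (fun i j => (w i).1 * (w j).2)]
  rcases n with _ | n
  · simp [hw0, h0]
  rw [(hw (n + 1)).2.2.2 n.succ_pos, Finset.sum_range_succ, Finset.sum_range_succ']
  simp only [Nat.add_sub_cancel, Nat.sub_self, Nat.sub_zero, hw0]
  rw [add_assoc]
  congr 1
  exact Finset.sum_congr rfl fun i _ => by rw [show n + 1 - (i + 1) = n - i by omega]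

end Lifting

section Forms

variable {K : Type u} [Field K]

open Polynomial

/-- Forms of weighted degree `k` for coprime weights are, up to a power of `s`, polynomials in
`s^a`. -/
lemma exists_eq_X_pow_mul_expand {a b k t : ℕ} (ha : 0 < a) (hab : Nat.Coprime a b) (hta : t < a)
    (ht : b * t ≡ k [MOD a]) {P : K[X]} (hP : P ∈ formSpace K a b k) :
    ∃ Q : K[X], P = X ^ t * expand K a Q := by
  have hmod : ∀ j, P.coeff j ≠ 0 → j % a = t := by
    intro j hj
    obtain ⟨i, hi⟩ := hP j hj
    have h1 : b * j ≡ b * t [MOD a] := by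
      refine Nat.ModEq.trans ?_ ht.symm
      rw [← hi]
      simp [Nat.ModEq]
    have h2 := Nat.ModEq.cancel_left_of_coprime hab h1
    rw [h2, Nat.mod_eq_of_lt hta]
  refine ⟨contract a (divX^[t] P), ?_⟩
  have hdiv : ∀ (n : ℕ) (P : K[X]) (j : ℕ), (divX^[n] P).coeff j = P.coeff (j + n) := by
    intro n
    induction n with
    | zero => simp
    | succ n ih => intro P j; rw [Function.iterate_succ_apply, ih, coeff_divX]; rfl
  ext j
  rw [coeff_X_pow_mul']
  split_ifs with h
  · rw [coeff_expand ha]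
    split_ifs with h2
    · rw [coeff_contract ha.ne', hdiv, Nat.div_mul_cancel h2, Nat.sub_add_cancel h]
    · by_contra hne
      apply h2
      rw [← hmod j hne]
      exact Nat.dvd_sub_mod j
  · by_contra hne
    exact h (by rw [← hmod j hne]; exact Nat.mod_le _ _)

lemma X_pow_mul_expand_mem_iff {a b k t : ℕ} (ha : 0 < a)
    (ht : b * t ≡ k [MOD a]) {Q : K[X]} :
    X ^ t * expand K a Q ∈ formSpace K a b k ↔ (Q ≠ 0 → b * t + a * b * Q.natDegree ≤ k) := by
  constructor
  · intro h hQ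
    obtain ⟨i, hi⟩ := h (Q.natDegree * a + t) (by
      rw [coeff_X_pow_mul, coeff_expand_mul ha]
      simpa using hQ)
    rw [← hi]
    nlinarith [Nat.zero_le (a * i)]
  · intro h j hj
    rw [coeff_X_pow_mul'] at hj
    obtain ⟨htj, hj⟩ := ite_ne_right_iff.mp hj
    rw [coeff_expand ha] at hj
    obtain ⟨hdvd, hj⟩ := ite_ne_right_iff.mp hj
    obtain ⟨e, he⟩ := hdvd
    rw [he, Nat.mul_div_cancel_left _ ha] at hj
    have hle : b * j ≤ k := by
      have h1 := h (by rintro rfl; simp at hj)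
      have h2 := le_natDegree_of_ne_zero hj
      obtain rfl : j = t + a * e := by omega
      have h3 := Nat.mul_le_mul_left (a * b) h2
      calc b * (t + a * e) = b * t + a * b * e := by ring
        _ ≤ k := by omega
    have hmod : b * j ≡ k [MOD a] := by
      refine Nat.ModEq.trans ?_ ht
      obtain rfl : j = t + a * e := by omega
      have : b * (t + a * e) = b * t + a * (b * e) := by ring
      rw [this]
      simp [Nat.ModEq]
    obtain ⟨i, hi⟩ := (Nat.modEq_iff_dvd' hle).mp hmod
    exact ⟨i, by omega⟩

lemma expand_mem_formSpace {a b d : ℕ} (ha : 0 < a) {Q : K[X]} (hQ : Q.natDegree ≤ d) :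
    expand K a Q ∈ formSpace K a b (a * b * d) := by
  have := (X_pow_mul_expand_mem_iff (K := K) (a := a) (b := b) (k := a * b * d) (t := 0) ha
    (by simp [Nat.ModEq, mul_assoc]) (Q := Q)).mpr
    (fun _ => by simpa using Nat.mul_le_mul_left _ hQ)
  simpa using this

lemma exists_eq_expand {a b d : ℕ} (ha : 0 < a) (hb : 0 < b) (hab : Nat.Coprime a b) {P : K[X]}
    (hP : P ∈ formSpace K a b (a * b * d)) :
    ∃ Q : K[X], P = expand K a Q ∧ Q.natDegree ≤ d := by
  have ht : b * 0 ≡ a * b * d [MOD a] := by simp [Nat.ModEq, mul_assoc]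
  obtain ⟨Q, rfl⟩ := exists_eq_X_pow_mul_expand ha hab ha ht hP
  refine ⟨Q, by simp, ?_⟩
  by_cases hQ : Q = 0
  · simp [hQ]
  have := (X_pow_mul_expand_mem_iff ha ht).mp hP hQ
  rw [mul_zero, zero_add] at this
  exact Nat.le_of_mul_le_mul_left this (Nat.mul_pos ha hb)

/-- If `c` is not a root of `Q`, every form of weighted degree larger than `a b (d + 1)` is a
combination of `y^a - c x^b` and of the form defined by `Q`. -/
lemma exists_solution {a b d : ℕ} (ha : 0 < a) (hab : Nat.Coprime a b) {c : K}
    {Q : K[X]} (hQ : Q.natDegree ≤ d) (hc : Q.eval c ≠ 0) (e : ℕ) {F : K[X]}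
    (hF : F ∈ formSpace K a b (a * b * 1 + a * b * d + e)) :
    ∃ u ∈ formSpace K a b (a * b * 1 + e), ∃ v ∈ formSpace K a b (a * b * d + e),
      F = expand K a (X - C c) * v + u * expand K a Q := by
  obtain ⟨t, hta, ht⟩ : ∃ t < a, b * t ≡ e [MOD a] := by
    obtain ⟨t, hta, ht⟩ := Nat.exists_mul_mod_eq_of_coprime e hab.symm ha.ne'
    exact ⟨t, hta, ht⟩
  have hmod : ∀ r, b * t ≡ a * b * r + e [MOD a] := fun r => by
    refine ht.trans ?_
    simp [Nat.ModEq, mul_assoc]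
  have hF' : F ∈ formSpace K a b (a * b * (d + 1) + e) := by
    rwa [show a * b * (d + 1) + e = a * b * 1 + a * b * d + e by ring]
  obtain ⟨P, rfl⟩ := exists_eq_X_pow_mul_expand ha hab hta (hmod _) hF'
  have hP := (X_pow_mul_expand_mem_iff ha (hmod _)).mp hF'
  have hroot : (P - C (P.eval c / Q.eval c) * Q).IsRoot c := by
    simp [div_mul_cancel₀ _ hc]
  obtain ⟨v, hv⟩ := dvd_iff_isRoot.mpr hroot
  have hbt : b * t ≤ a * b := by rw [mul_comm a]; exact Nat.mul_le_mul_left b hta.le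
  refine ⟨X ^ t * expand K a (C (P.eval c / Q.eval c)),
    (X_pow_mul_expand_mem_iff ha (hmod _)).mpr fun _ => by simp; omega,
    X ^ t * expand K a v, (X_pow_mul_expand_mem_iff ha (hmod _)).mpr fun hv0 => ?_, ?_⟩
  · have hdeg : v.natDegree + 1 = (P - C (P.eval c / Q.eval c) * Q).natDegree := by
      rw [hv, natDegree_mul (X_sub_C_ne_zero c) hv0, natDegree_X_sub_C, add_comm]
    have hle := natDegree_sub_le P (C (P.eval c / Q.eval c) * Q)
    have hle2 := (natDegree_C_mul_le (P.eval c / Q.eval c) Q).trans hQ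
    rcases le_total (v.natDegree + 1) d with h | h
    · have := Nat.mul_le_mul_left (a * b) h
      rw [mul_add] at this
      omega
    · have h1 : v.natDegree + 1 ≤ P.natDegree ∨ v.natDegree + 1 ≤ d := by
        rcases le_max_iff.mp hle with h | h <;> omega
      rcases h1 with h1 | h1
      · have := Nat.mul_le_mul_left (a * b) h1
        have h2 := hP (by rintro rfl; simp at h1)
        rw [mul_add] at this h2
        omega
      · have := Nat.mul_le_mul_left (a * b) h1
        rw [mul_add] at this
        omega
  · have : P = (X - C c) * v + C (P.eval c / Q.eval c) * Q := by rw [← hv]; ring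
    conv_lhs => rw [this]
    simp only [map_add, map_mul]
    ring

end Forms

section Polygon

/-- A set of lattice points with a lowest point `(0,n)` on the vertical axis and some point below
that height has an edge starting at `(0,n)`. -/
lemma exists_first_edge {T : Set (ℕ × ℕ)} {n : ℕ} (hmin : ∀ b, (0, b) ∈ T → n ≤ b)
    (hT : ∃ p ∈ T, p.2 < n) :
    ∃ p ∈ T, 0 < p.1 ∧ p.2 < n ∧ ∃ w : ℕ × ℕ, 0 < w.1 ∧ 0 < w.2 ∧
      w.1 * p.1 + w.2 * p.2 = w.2 * n ∧
      (∀ r ∈ T, w.2 * n ≤ w.1 * r.1 + w.2 * r.2) ∧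
      (∀ r ∈ T, w.1 * r.1 + w.2 * r.2 = w.2 * n → r.1 ≤ p.1 ∧ p.2 ≤ r.2 ∧ r.2 ≤ n) := by
  let M : ℕ × ℕ → ℕ := fun p => (n.factorial / (n - p.2) * p.1) * (n + 1) + p.2
  obtain ⟨p, ⟨hpT, hpn⟩, hpmin⟩ := (measure M).wf.has_min {p | p ∈ T ∧ p.2 < n} hT
  have hfac : ∀ q : ℕ × ℕ, q.2 < n → n.factorial / (n - q.2) * (n - q.2) = n.factorial :=
    fun q hq => Nat.div_mul_cancel (Nat.dvd_factorial (by omega) (by omega))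
  have hp1 : 0 < p.1 := by
    rcases Nat.eq_zero_or_pos p.1 with h | h
    · have := hmin p.2 (by rw [← h]; exact hpT)
      omega
    · exact h
  have hle : ∀ r ∈ T, r.2 < n → M p ≤ M r := fun r hr hrn => by
    have := hpmin r ⟨hr, hrn⟩
    exact not_lt.mp this
  have hF := Nat.factorial_pos n
  have key : ∀ r ∈ T, r.2 < n → p.1 * (n - r.2) ≤ (n - p.2) * r.1 ∧
      (p.1 * (n - r.2) = (n - p.2) * r.1 → p.2 ≤ r.2) := by
    intro r hr hrn
    have h1 := hle r hr hrn
    simp only [M] at h1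
    have hP := hfac p hpn
    have hR := hfac r hrn
    set cp := n.factorial / (n - p.2)
    set cr := n.factorial / (n - r.2)
    have e1 : n.factorial * (p.1 * (n - r.2)) = (cp * p.1) * ((n - p.2) * (n - r.2)) := by
      rw [← hP]; ring
    have e2 : n.factorial * ((n - p.2) * r.1) = (cr * r.1) * ((n - p.2) * (n - r.2)) := by
      rw [← hR]; ring
    have h2 : cp * p.1 ≤ cr * r.1 := by
      by_contra! hlt
      have := Nat.mul_le_mul_right (n + 1) (Nat.succ_le_of_lt hlt)
      rw [Nat.succ_mul] at this
      omega
    refine ⟨Nat.le_of_mul_le_mul_left (by rw [e1, e2]; exact Nat.mul_le_mul_right _ h2) hF,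
      fun heq => ?_⟩
    rw [← heq, e1] at e2
    have h3 := Nat.eq_of_mul_eq_mul_right (Nat.mul_pos (by omega) (by omega)) e2
    rw [h3] at h1
    omega
  refine ⟨p, hpT, hp1, hpn, (n - p.2, p.1), by simp; omega, hp1, ?_, ?_, ?_⟩
  · simp only
    rw [mul_comm, ← mul_add, Nat.sub_add_cancel hpn.le]
  · intro r hr
    simp only
    rcases lt_or_ge r.2 n with h | h
    · have h1 := (key r hr h).1
      have h2 : p.1 * (n - r.2) + p.1 * r.2 = p.1 * n := by
        rw [← mul_add, Nat.sub_add_cancel h.le]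
      omega
    · have := Nat.mul_le_mul_left p.1 h
      omega
  · intro r hr heq
    simp only at heq
    rcases lt_or_ge r.2 n with h | h
    · have h2 : p.1 * (n - r.2) + p.1 * r.2 = p.1 * n := by
        rw [← mul_add, Nat.sub_add_cancel h.le]
      have h3 := (key r hr h).2 (by omega)
      refine ⟨?_, h3, h.le⟩
      have h4 : p.1 * (n - r.2) ≤ p.1 * (n - p.2) := Nat.mul_le_mul_left _ (by omega)
      have h5 : (n - p.2) * r.1 ≤ (n - p.2) * p.1 := by
        rw [mul_comm (n - p.2) p.1]
        omega
      exact Nat.le_of_mul_le_mul_left h5 (by omega)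
    · have h1 := Nat.mul_le_mul_left p.1 h
      have h2 : p.1 * r.2 = p.1 * n := by omega
      have h3 := Nat.eq_of_mul_eq_mul_left hp1 h2
      have h4 : (n - p.2) * r.1 = 0 := by omega
      rcases Nat.mul_eq_zero.mp h4 with h5 | h5 <;> omega

variable {K : Type u} [Field K]

/-- The single edge of an elementary series joins the two coordinate axes. -/
lemma edge_of_newtonPolygon_eq_singleton {f : PS K} (hconv : Convenient K f) {S : NEdge}
    (hS : newtonPolygon K f = {S}) :
    0 < ordX K f ∧ 0 < ordY K f ∧ S.A = (0, ordY K f) ∧ S.B = (ordX K f, 0) ∧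
      ∀ p ∈ supp K f, ordX K f * ordY K f ≤ ordY K f * p.1 + ordX K f * p.2 := by
  have hXmem : (ordX K f, 0) ∈ supp K f := Nat.sInf_mem hconv.1
  have hYmem : (0, ordY K f) ∈ supp K f := Nat.sInf_mem hconv.2
  have hXmin : ∀ a, (a, 0) ∈ supp K f → ordX K f ≤ a := fun a h => Nat.sInf_le h
  have hYmin : ∀ b, (0, b) ∈ supp K f → ordY K f ≤ b := fun b h => Nat.sInf_le h
  have hSmem : S ∈ newtonPolygon K f := by rw [hS]; exact Set.mem_singleton S
  obtain ⟨-, -, w, hw1, hw2, hweq, hwle, -⟩ := hSmem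
  have h00 : (0, 0) ∉ supp K f := fun h => by
    have h1 := hwle _ h
    have h2 := Nat.mul_pos hw2 ((Nat.zero_le _).trans_lt S.hy)
    simp only [mul_zero, add_zero] at h1
    omega
  have hm : 0 < ordX K f := Nat.pos_of_ne_zero fun h => h00 (by rwa [h] at hXmem)
  have hn : 0 < ordY K f := Nat.pos_of_ne_zero fun h => h00 (by rwa [h] at hYmem)
  have hA : S.A = (0, ordY K f) := by
    obtain ⟨p, hp, hp1, hpn, v, hv1, hv2, hveq, hvle, hvmem⟩ :=
      exists_first_edge hYmin ⟨_, hXmem, hn⟩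
    have : (⟨(0, ordY K f), p, hp1, hpn⟩ : NEdge) ∈ newtonPolygon K f :=
      ⟨hYmem, hp, v, hv1, hv2, by simpa using hveq, fun r hr => by simpa using hvle r hr,
        fun r hr h => ⟨Nat.zero_le _, (hvmem r hr (by simpa using h)).1⟩⟩
    rw [hS, Set.mem_singleton_iff] at this
    rw [← this]
  have hB : S.B = (ordX K f, 0) := by
    obtain ⟨p, hp, hp1, hpn, v, hv1, hv2, hveq, hvle, hvmem⟩ :=
      exists_first_edge (T := {q | q.swap ∈ supp K f}) hXmin ⟨(ordY K f, 0), hYmem, hm⟩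
    have : (⟨p.swap, (ordX K f, 0), hpn, hp1⟩ : NEdge) ∈ newtonPolygon K f := by
      refine ⟨hp, hXmem, v.swap, hv2, hv1, ?_, fun r hr => ?_, fun r hr h => ?_⟩
      · simp only [Prod.fst_swap, Prod.snd_swap]
        omega
      · have := hvle r.swap (by simpa using hr)
        simp only [Prod.fst_swap, Prod.snd_swap] at this ⊢
        omega
      · have := hvmem r.swap (by simpa using hr)
        simp only [Prod.fst_swap, Prod.snd_swap] at this h ⊢
        exact (this (by omega)).2
    rw [hS, Set.mem_singleton_iff] at this
    rw [← this]
  refine ⟨hm, hn, hA, hB, fun p hp => ?_⟩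
  have h1 := hwle p hp
  simp only [hA, hB, mul_zero, add_zero, zero_add] at h1 hweq
  refine Nat.le_of_mul_le_mul_left (c := w.1) ?_ hw1
  calc w.1 * (ordX K f * ordY K f) = ordY K f * (w.2 * ordY K f) := by rw [← hweq]; ring
    _ ≤ ordY K f * (w.1 * p.1 + w.2 * p.2) := Nat.mul_le_mul_left _ h1
    _ = w.1 * (ordY K f * p.1) + (w.2 * ordY K f) * p.2 := by ring
    _ = w.1 * (ordY K f * p.1 + ordX K f * p.2) := by rw [← hweq]; ring

end Polygon

section Factors

variable {K : Type u} [Field K]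

open Polynomial

lemma not_isUnit_of_weightedSubst_eq {a b : ℕ} (ha : 0 < a) (hb : 0 < b) {f : PS K} {N : ℕ}
    (hN : 0 < N) {F : PowerSeries K[X]}
    (hf : weightedSubst K ha hb f = PowerSeries.X ^ N * F) : ¬ IsUnit f := by
  intro hu
  have h := (hu.map (weightedSubst K ha hb)).map PowerSeries.constantCoeff
  rw [hf] at h
  simp [hN.ne'] at h

lemma exists_weightedSubst_eq_X_pow_mul {a b : ℕ} (ha : 0 < a) (hb : 0 < b) {N : ℕ}
    {F : PowerSeries K[X]} (hF : ∀ e, PowerSeries.coeff e F ∈ formSpace K a b (N + e)) :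
    ∃ f, weightedSubst K ha hb f = PowerSeries.X ^ N * F := by
  refine exists_weightedSubst_eq ha hb fun k => ?_
  rw [PowerSeries.coeff_X_pow_mul']
  split_ifs with h
  · have := hF (k - N)
    rwa [Nat.add_sub_cancel' h] at this
  · exact Submodule.zero_mem _

lemma exists_weightedSubst_eq_expand {a b : ℕ} (ha : 0 < a) (hb : 0 < b) {d : ℕ} {Q : K[X]}
    (hQ : Q.natDegree ≤ d) :
    ∃ f, weightedSubst K ha hb f =
      PowerSeries.X ^ (a * b * d) * PowerSeries.C (expand K a Q) := by
  refine exists_weightedSubst_eq_X_pow_mul ha hb fun e => ?_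
  rw [PowerSeries.coeff_C]
  split_ifs with h
  · simpa [h] using expand_mem_formSpace ha hQ
  · exact Submodule.zero_mem _

/-- A series whose initial form has `y^a - c x^b` as a simple proper factor is reducible. -/
lemma not_irreducible_of_simple_root {a b d : ℕ} (ha : 0 < a) (hb : 0 < b)
    (hab : Nat.Coprime a b) (hd : 0 < d) {f : PS K} {F : PowerSeries K[X]}
    (hf : weightedSubst K ha hb f = PowerSeries.X ^ (a * b * 1 + a * b * d) * F) {c : K}
    {Q : K[X]} (hQ : Q.natDegree ≤ d) (hc : Q.eval c ≠ 0)
    (hF : PowerSeries.coeff 0 F = expand K a ((X - C c) * Q)) : ¬ Irreducible f := by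
  have hpos := Nat.mul_pos ha hb
  obtain ⟨G, H, hG, hH, hGH⟩ := exists_lift_mul (formSpace K a b)
    (fun _ _ _ _ hP hQ => mul_mem_formSpace hP hQ)
    (expand_mem_formSpace (b := b) ha (natDegree_X_sub_C c).le) (expand_mem_formSpace ha hQ)
    (fun e _ _ hmem => exists_solution ha hab hQ hc e hmem) F
    (fun e => by
      have := coeff_weightedSubst_mem ha hb f (e + (a * b * 1 + a * b * d))
      rwa [hf, PowerSeries.coeff_X_pow_mul, add_comm] at this)
    (by rw [hF, map_mul])
  obtain ⟨g, hg⟩ := exists_weightedSubst_eq_X_pow_mul ha hb hG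
  obtain ⟨h, hh⟩ := exists_weightedSubst_eq_X_pow_mul ha hb hH
  have hfgh : f = g * h := by
    apply weightedSubst_injective ha hb
    rw [map_mul, hf, hg, hh, hGH]
    ring
  intro hirr
  rcases hirr.isUnit_or_isUnit hfgh with hu | hu
  · exact not_isUnit_of_weightedSubst_eq ha hb (by omega) hg hu
  · exact not_isUnit_of_weightedSubst_eq ha hb (Nat.mul_pos hpos hd) hh hu

/-- A form having a multiple factor `y^a - c x^b` is not squarefree. -/
lemma not_squarefree_of_double_root {a b d : ℕ} (ha : 0 < a) (hb : 0 < b) {f : PS K} {P : K[X]}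
    (hP0 : P ≠ 0) (hP : P.natDegree ≤ d)
    (hf : weightedSubst K ha hb f = PowerSeries.X ^ (a * b * d) * PowerSeries.C (expand K a P))
    {c : K} (hc : (X - C c) * (X - C c) ∣ P) : ¬ Squarefree f := by
  obtain ⟨M, rfl⟩ := hc
  have hM0 : M ≠ 0 := right_ne_zero_of_mul hP0
  have hX := X_sub_C_ne_zero c
  rw [natDegree_mul (mul_ne_zero hX hX) hM0, natDegree_mul hX hX, natDegree_X_sub_C] at hP
  obtain ⟨e, rfl⟩ := Nat.exists_eq_add_of_le hP
  obtain ⟨g, hg⟩ := exists_weightedSubst_eq_expand ha hb (natDegree_X_sub_C c).le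
  obtain ⟨h, hh⟩ := exists_weightedSubst_eq_expand (K := K) ha hb
    (Q := M) (Nat.le_add_right M.natDegree e)
  have hfgh : f = g * g * h := by
    apply weightedSubst_injective ha hb
    rw [map_mul, map_mul, hf, hg, hh]
    simp only [map_mul]
    ring
  intro hsq
  refine not_isUnit_of_weightedSubst_eq ha hb ?_ hg (hsq g ⟨h, hfgh⟩)
  simpa using ⟨ha, hb⟩

/-- `weightedLead ha hb f` is the dehomogenization of the initial form of `f` for the weights
`a, b`. -/
def weightedLead {a b : ℕ} (ha : 0 < a) (hb : 0 < b) (f : PS K) : K[X] :=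
  PowerSeries.coeff (weightedSubst K ha hb f).order.toNat (weightedSubst K ha hb f)

lemma weightedLead_eq {a b : ℕ} (ha : 0 < a) (hb : 0 < b) (f : PS K) :
    weightedLead ha hb f = PowerSeries.constantCoeff (weightedSubst K ha hb f).divXPowOrder :=
  PowerSeries.constantCoeff_divXPowOrder.symm

lemma weightedLead_prod {a b : ℕ} (ha : 0 < a) (hb : 0 < b) {ι : Type*} (s : Finset ι)
    (f : ι → PS K) :
    weightedLead ha hb (∏ i ∈ s, f i) = ∏ i ∈ s, weightedLead ha hb (f i) := by
  simp only [weightedLead_eq, map_prod, PowerSeries.divXPowOrder_prod]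

lemma weightedLead_mem {a b N : ℕ} (ha : 0 < a) (hb : 0 < b) {f : PS K}
    (hN : (weightedSubst K ha hb f).order = N) : weightedLead ha hb f ∈ formSpace K a b N := by
  have := coeff_weightedSubst_mem ha hb f N
  rwa [weightedLead, hN, ENat.toNat_natCast]

/-- A series whose initial form for the weights `a, b` has degree `a b d` and contains the
monomials `x^(b d)` and `y^(a d)` has bidegree `(b d, a d)`. -/
lemma ordX_eq_and_ordY_eq {a b d : ℕ} (ha : 0 < a) (hb : 0 < b) {f : PS K}
    (hN : (weightedSubst K ha hb f).order = (a * b * d : ℕ))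
    (h0 : (weightedLead ha hb f).coeff 0 ≠ 0) (hd : (weightedLead ha hb f).coeff (a * d) ≠ 0) :
    ordX K f = b * d ∧ ordY K f = a * d := by
  rw [weightedLead, hN, ENat.toNat_natCast] at h0 hd
  rw [coeff_weightedSubst_of_eq ha hb f (i := b * d) (by ring)] at h0
  rw [coeff_weightedSubst_of_eq ha hb f (i := 0) (by ring)] at hd
  have hmin : ∀ i j, coef K f (i, j) ≠ 0 → a * b * d ≤ a * i + b * j := by
    intro i j hij
    rw [← coeff_weightedSubst_of_eq ha hb f rfl] at hij
    have := PowerSeries.order_le (φ := weightedSubst K ha hb f) (a * i + b * j)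
      (fun h => hij (by rw [h, coeff_zero]))
    rw [hN] at this
    exact_mod_cast this
  refine ⟨le_antisymm (Nat.sInf_le h0) (le_csInf ⟨_, h0⟩ fun i hi => ?_),
    le_antisymm (Nat.sInf_le hd) (le_csInf ⟨_, hd⟩ fun j hj => ?_)⟩
  · have := hmin i 0 hi
    rw [mul_zero, add_zero, mul_assoc] at this
    exact Nat.le_of_mul_le_mul_left this ha
  · have := hmin 0 j hj
    rw [mul_zero, zero_add, mul_comm a b, mul_assoc] at this
    exact Nat.le_of_mul_le_mul_left this hb

/-- The factors of a series whose initial form contains powers of both variables have initial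
forms of the same kind. -/
lemma exists_factor_degrees {a b D : ℕ} (ha : 0 < a) (hb : 0 < b) (hab : Nat.Coprime a b)
    {ι : Type*} [Fintype ι] {f : ι → PS K}
    (hN : (weightedSubst K ha hb (∏ i, f i)).order = (a * b * D : ℕ))
    (h0 : (weightedLead ha hb (∏ i, f i)).coeff 0 ≠ 0)
    (hD : (weightedLead ha hb (∏ i, f i)).coeff (a * D) ≠ 0) :
    ∃ d : ι → ℕ, ∑ i, d i = D ∧ ∀ i,
      (weightedSubst K ha hb (f i)).order = (a * b * d i : ℕ) ∧
      (weightedLead ha hb (f i)).natDegree = a * d i ∧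
      (weightedLead ha hb (f i)).coeff 0 ≠ 0 := by
  have hdeg : (weightedLead ha hb (∏ i, f i)).natDegree = a * D := by
    refine le_antisymm ?_ (le_natDegree_of_ne_zero hD)
    obtain ⟨i, hi⟩ := weightedLead_mem ha hb hN _
      (leadingCoeff_ne_zero.mpr (fun h => h0 (by rw [h, coeff_zero])))
    refine Nat.le_of_mul_le_mul_left (c := b) ?_ hb
    calc b * (weightedLead ha hb (∏ i, f i)).natDegree ≤ a * b * D := by omega
      _ = b * (a * D) := by ring
  have hord : ∀ i, ∃ N : ℕ, (weightedSubst K ha hb (f i)).order = N := by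
    intro i
    refine ⟨_, (PowerSeries.coe_toNat_order fun h => ?_).symm⟩
    rw [map_prod, Finset.prod_eq_zero (Finset.mem_univ i) h, PowerSeries.order_zero] at hN
    exact ENat.top_ne_natCast _ hN
  choose N hNi using hord
  have hsumN : ∑ i, N i = a * b * D := by
    rw [map_prod, PowerSeries.order_prod] at hN
    simp only [hNi] at hN
    exact_mod_cast hN
  rw [weightedLead_prod] at h0 hdeg
  rw [coeff_zero_prod] at h0
  have h0i : ∀ i, (weightedLead ha hb (f i)).coeff 0 ≠ 0 := fun i =>
    Finset.prod_ne_zero_iff.mp h0 i (Finset.mem_univ i)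
  have hne : ∀ i, weightedLead ha hb (f i) ≠ 0 := fun i h => h0i i (by rw [h, coeff_zero])
  rw [natDegree_prod _ _ fun i _ => hne i] at hdeg
  have hle : ∀ i ∈ Finset.univ, b * (weightedLead ha hb (f i)).natDegree ≤ N i := fun i _ => by
    obtain ⟨l, hl⟩ := weightedLead_mem ha hb (hNi i) _ (leadingCoeff_ne_zero.mpr (hne i))
    omega
  have heq := (Finset.sum_eq_sum_iff_of_le hle).mp (by rw [← Finset.mul_sum, hdeg, hsumN]; ring)
  have hdvd : ∀ i, ∃ d, (weightedLead ha hb (f i)).natDegree = a * d := fun i => by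
    obtain ⟨l, hl⟩ := weightedLead_mem ha hb (hNi i) 0 (h0i i)
    have hmul : a ∣ b * (weightedLead ha hb (f i)).natDegree :=
      ⟨l, by rw [heq i (Finset.mem_univ i), ← hl]; ring⟩
    exact hab.dvd_of_dvd_mul_left hmul
  choose d hd using hdvd
  refine ⟨d, ?_, fun i => ⟨?_, hd i, h0i i⟩⟩
  · refine Nat.eq_of_mul_eq_mul_left ha ?_
    rw [Finset.mul_sum, ← hdeg]
    exact Finset.sum_congr rfl fun i _ => (hd i).symm
  · rw [hNi i, ← heq i (Finset.mem_univ i), hd i]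
    congr 1
    ring

/-- The initial form of an irreducible series of degree at least `2 a b` has a multiple factor
`y^a - c x^b`. -/
lemma exists_double_root [IsAlgClosed K] {a b d : ℕ} (ha : 0 < a) (hb : 0 < b)
    (hab : Nat.Coprime a b) {f : PS K} (hirr : Irreducible f) (hd : 2 ≤ d)
    (hN : (weightedSubst K ha hb f).order = (a * b * d : ℕ)) {Q : K[X]}
    (hQ : Q.natDegree = d) (hlead : weightedLead ha hb f = expand K a Q) :
    ∃ c : K, (X - C c) * (X - C c) ∣ Q := by
  have hQ0 : Q ≠ 0 := by rintro rfl; simp at hQ; omega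
  obtain ⟨c, hc⟩ := IsAlgClosed.exists_root Q (by
    rw [degree_eq_natDegree hQ0, hQ]
    exact_mod_cast (by omega : d ≠ 0))
  obtain ⟨M, rfl⟩ := dvd_iff_isRoot.mpr hc
  have hM0 : M ≠ 0 := right_ne_zero_of_mul hQ0
  rw [natDegree_mul (X_sub_C_ne_zero c) hM0, natDegree_X_sub_C] at hQ
  refine ⟨c, mul_dvd_mul_left _ (dvd_iff_isRoot.mpr ?_)⟩
  by_contra hcM
  refine not_irreducible_of_simple_root ha hb hab (d := M.natDegree) (by omega)
    (F := (weightedSubst K ha hb f).divXPowOrder) ?_ le_rfl hcM ?_ hirr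
  · conv_lhs => rw [← PowerSeries.X_pow_order_mul_divXPowOrder (f := weightedSubst K ha hb f)]
    rw [hN, ENat.toNat_natCast, ← hQ, mul_add]
  · rw [← hlead, weightedLead_eq, PowerSeries.coeff_zero_eq_constantCoeff_apply]

/-- The initial form along an edge joining the axes is the part of lowest weighted degree. -/
lemma weightedSubst_inBar {a b D : ℕ} (ha : 0 < a) (hb : 0 < b) (hD : 0 < D) (f : PS K)
    {S : NEdge} (hA : S.A = (0, a * D)) (hB : S.B = (b * D, 0)) :
    weightedSubst K ha hb (inBar K f S) = PowerSeries.X ^ (a * b * D) *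
      PowerSeries.C (PowerSeries.coeff (a * b * D) (weightedSubst K ha hb f)) := by
  have hmem : ∀ i j, S.mem (i, j) ↔ a * i + b * j = a * b * D := by
    intro i j
    simp only [NEdge.mem, NEdge.len1, NEdge.len2, hA, hB, Nat.sub_zero, Nat.zero_le, true_and]
    constructor
    · rintro ⟨-, hj, h⟩
      have h1 : D * (a * i + b * j) = D * (a * b * D) := by
        calc D * (a * i + b * j) = i * (a * D) + b * D * j := by ring
          _ = b * D * ((a * D - j) + j) := by rw [h]; ring
          _ = D * (a * b * D) := by rw [Nat.sub_add_cancel hj]; ring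
      exact Nat.eq_of_mul_eq_mul_left hD h1
    · intro h
      have hi : i ≤ b * D := Nat.le_of_mul_le_mul_left (c := a) (by rw [← mul_assoc]; omega) ha
      have hj : j ≤ a * D := Nat.le_of_mul_le_mul_left (c := b)
        (by rw [← mul_assoc, mul_comm b a]; omega) hb
      refine ⟨hi, hj, ?_⟩
      obtain ⟨l, hl⟩ := Nat.exists_eq_add_of_le hj
      rw [hl, Nat.add_sub_cancel_left]
      have h2 : a * i = b * l := by
        have : a * b * D = b * j + b * l := by rw [← mul_add, ← hl]; ring
        omega
      rw [← hl]
      calc i * (a * D) = a * i * D := by ring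
        _ = l * (b * D) := by rw [h2]; ring
  ext k j
  rw [PowerSeries.coeff_X_pow_mul', PowerSeries.coeff_C]
  by_cases h : ∃ i, a * i + b * j = k
  · obtain ⟨i, hi⟩ := h
    rw [coeff_weightedSubst_of_eq ha hb _ hi, inBar, coef_ofCoef]
    simp only [hA, hB, add_zero, hmem, hi]
    split_ifs with h1 h2 h3 h3
    · rw [← h1, coeff_weightedSubst_of_eq ha hb _ hi]
    · omega
    · omega
    · omega
    · simp
    · simp
  · rw [not_imp_comm.mp (coeff_weightedSubst_mem ha hb _ k j) h]
    split_ifs with h1 h2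
    · have hk : k = a * b * D := by omega
      rw [← hk, not_imp_comm.mp (coeff_weightedSubst_mem ha hb _ k j) h]
    · simp
    · simp

end Factors

theorem elementary_factors (K : Type u) [Field K] [IsAlgClosed K]
    (f : PS K) (hconv : Convenient K f) (S : NEdge) (hS : newtonPolygon K f = {S})
    (m n : ℕ) (hm : m = ordX K f) (hn : n = ordY K f)
    (r : ℕ) (fi : Fin r → PS K) (hfac : f = ∏ i, fi i) (hirr : ∀ i, Irreducible (fi i)) :
    (∀ i, ordX K (fi i) / Nat.gcd (ordX K (fi i)) (ordY K (fi i)) = m / Nat.gcd m n ∧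
        ordY K (fi i) / Nat.gcd (ordX K (fi i)) (ordY K (fi i)) = n / Nat.gcd m n) ∧
      (∑ i, Nat.gcd (ordX K (fi i)) (ordY K (fi i))) = Nat.gcd m n ∧
      r ≤ Nat.gcd m n ∧ (NonDegenerate K f → r = Nat.gcd m n) := by
  obtain ⟨hm0, hn0, hA, hB, hle⟩ := edge_of_newtonPolygon_eq_singleton hconv hS
  have hXmem : (ordX K f, 0) ∈ supp K f := Nat.sInf_mem hconv.1
  have hYmem : (0, ordY K f) ∈ supp K f := Nat.sInf_mem hconv.2
  rw [← hm] at hm0 hB hle hXmem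
  rw [← hn] at hn0 hA hle hYmem
  clear hm hn
  have hD : 0 < Nat.gcd m n := Nat.gcd_pos_of_pos_left _ hm0
  obtain ⟨b, a, hba, hmb, hna⟩ := Nat.exists_coprime m n
  generalize Nat.gcd m n = D at *
  subst hmb hna
  have ha : 0 < a := Nat.pos_of_mul_pos_right hn0
  have hb : 0 < b := Nat.pos_of_mul_pos_right hm0
  have hab : Nat.Coprime a b := hba.symm
  have hcoef : ∀ k < a * b * D, PowerSeries.coeff k (weightedSubst K ha hb f) = 0 := by
    intro k hk
    ext j
    by_contra hne
    obtain ⟨i, hi⟩ := exists_of_coeff_weightedSubst_ne_zero ha hb hne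
    rw [coeff_weightedSubst_of_eq ha hb f hi, Polynomial.coeff_zero] at hne
    have h1 : D * (a * b * D) ≤ D * (a * i + b * j) := by
      have := hle (i, j) hne
      calc D * (a * b * D) = b * D * (a * D) := by ring
        _ ≤ _ := this
        _ = _ := by ring
    have := Nat.le_of_mul_le_mul_left h1 hD
    omega
  have hc0 : (PowerSeries.coeff (a * b * D) (weightedSubst K ha hb f)).coeff 0 ≠ 0 := by
    rw [coeff_weightedSubst_of_eq ha hb f (i := b * D) (by ring)]
    exact hXmem
  have hcD : (PowerSeries.coeff (a * b * D) (weightedSubst K ha hb f)).coeff (a * D) ≠ 0 := by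
    rw [coeff_weightedSubst_of_eq ha hb f (i := 0) (by ring)]
    exact hYmem
  have hN : (weightedSubst K ha hb f).order = (a * b * D : ℕ) :=
    PowerSeries.order_eq_nat.mpr ⟨fun h => hc0 (by rw [h, Polynomial.coeff_zero]), hcoef⟩
  have hlead : weightedLead ha hb f =
      PowerSeries.coeff (a * b * D) (weightedSubst K ha hb f) := by
    rw [weightedLead, hN, ENat.toNat_natCast]
  obtain ⟨d, hsum, hd⟩ := exists_factor_degrees ha hb hab (f := fi) (D := D)
    (by rw [← hfac, hN]) (by rwa [← hfac, hlead]) (by rwa [← hfac, hlead])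
  have hne : ∀ i, weightedLead ha hb (fi i) ≠ 0 := fun i h => (hd i).2.2 (by simp [h])
  have hord : ∀ i, ordX K (fi i) = b * d i ∧ ordY K (fi i) = a * d i := fun i =>
    ordX_eq_and_ordY_eq ha hb (hd i).1 (hd i).2.2
      (by rw [← (hd i).2.1]; exact Polynomial.leadingCoeff_ne_zero.mpr (hne i))
  have hdpos : ∀ i, 1 ≤ d i := by
    intro i
    by_contra! h0
    obtain h0 : d i = 0 := by omega
    refine (hirr i).not_isUnit (MvPowerSeries.isUnit_iff_constantCoeff.mpr (IsUnit.mk0 _ ?_))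
    have h1 := (hd i).2.2
    rw [weightedLead, (hd i).1, ENat.toNat_natCast, h0,
      coeff_weightedSubst_of_eq ha hb _ (i := 0) (by ring)] at h1
    simpa [coef] using h1
  have hgcd : ∀ i, Nat.gcd (b * d i) (a * d i) = d i := fun i => by
    rw [Nat.gcd_mul_right, hba.gcd_eq_one, one_mul]
  simp only [hord, hgcd]
  refine ⟨fun i => ?_, hsum, ?_, fun hnd => ?_⟩
  · simp [Nat.mul_div_cancel _ (hdpos i), Nat.mul_div_cancel _ hD]
  · rw [← hsum]
    simpa using Finset.sum_le_sum fun i (_ : i ∈ Finset.univ) => hdpos i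
  · have hsq := hnd S (by rw [hS]; rfl)
    have hexp : ∀ i, ∃ Q : Polynomial K, weightedLead ha hb (fi i) = Polynomial.expand K a Q ∧
        Q.natDegree ≤ d i := fun i =>
      exists_eq_expand ha hb hab (weightedLead_mem ha hb (hd i).1)
    choose Q hQ hQd using hexp
    have hQ0 : ∀ i, Q i ≠ 0 := fun i h => hne i (by rw [hQ, h, map_zero])
    have hone : ∀ i, d i = 1 := by
      intro i
      by_contra hdi
      have hdeg : (Q i).natDegree = d i := by
        refine Nat.eq_of_mul_eq_mul_left ha ?_
        rw [← (hd i).2.1, hQ, Polynomial.natDegree_expand, mul_comm]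
      obtain ⟨c, hc⟩ := exists_double_root ha hb hab (hirr i)
        (by have := hdpos i; omega) (hd i).1 hdeg (hQ i)
      refine not_squarefree_of_double_root ha hb (P := ∏ i, Q i) (d := D)
        (Finset.prod_ne_zero_iff.mpr fun i _ => hQ0 i) ?_ ?_
        (hc.trans (Finset.dvd_prod_of_mem Q (Finset.mem_univ i))) hsq
      · rw [Polynomial.natDegree_prod _ _ fun i _ => hQ0 i, ← hsum]
        exact Finset.sum_le_sum fun i _ => hQd i
      · rw [weightedSubst_inBar ha hb hD f (by rw [hA]) (by rw [hB]), ← hlead, hfac,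
          weightedLead_prod]
        simp only [hQ, map_prod]
    rw [← hsum]
    simp [hone]

end PlaneCurveNote
end
end
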